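/- arXiv:2406.17544 — 2 statements merged into one kernel-verified Lean document; each statement's English description precedes it below -/
import Mathlib

section
/- Let k > 1, 0 < δ < 1, let λ₁, λ₂, λ₃, λ₄ be non-zero real numbers and ω ∈ ℝ. There is a constant C > 0 (depending on k, δ and the λ_j) such that for all X ≥ 2, all η > 0, and all R ≥ max_j 2/|λ_j|, the trivial-arc contribution satisfies |ℐ(η,ω,𝔱)| ≤ C X^{1 + 1/(2k)} (log X)^{5/2} / R, where 𝔱 = { α ∈ ℝ : |α| > R }. -/
open scoped Classical
open MeasureTheory

noncomputable section

/-- `e x = exp(2πix)` -/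
def e (x : ℝ) : ℂ := Complex.exp (2 * Real.pi * Complex.I * x)

/-- The exponential sum `S_k(α)` over primes `p` with `δX ≤ p^k ≤ X`. -/
def S (k δ X α : ℝ) : ℂ :=
  ∑ p ∈ (Finset.range (⌈X⌉₊ + 1)).filter
      (fun p : ℕ => p.Prime ∧ δ * X ≤ (p : ℝ) ^ k ∧ (p : ℝ) ^ k ≤ X),
    (Real.log p : ℂ) * e ((p : ℝ) ^ k * α)

/-- The exponential sum `U_k(α)` over naturals `n` with `δX ≤ n^k ≤ X`. -/
def U (k δ X α : ℝ) : ℂ :=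
  ∑ n ∈ (Finset.range (⌈X⌉₊ + 1)).filter
      (fun n : ℕ => δ * X ≤ (n : ℝ) ^ k ∧ (n : ℝ) ^ k ≤ X),
    e ((n : ℝ) ^ k * α)

/-- The exponential integral `T_k(α)`. -/
def T (k δ X α : ℝ) : ℂ :=
  ∫ t in (δ * X) ^ (1 / k)..(X ^ (1 / k)), e (α * t ^ k)

/-- Chebyshev theta function. -/
def theta (x : ℝ) : ℝ :=
  ∑ p ∈ (Finset.range (⌊x⌋₊ + 1)).filter Nat.Prime, Real.log p

/-- The generalized Selberg integral `𝒥_k(X,h)`. -/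
def selbergJ (k X h : ℝ) : ℝ :=
  ∫ x in X..(2 * X),
    (theta ((x + h) ^ (1 / k)) - theta (x ^ (1 / k)) -
      ((x + h) ^ (1 / k) - x ^ (1 / k))) ^ 2

/-- `ψ(m,z) = 1` iff every prime factor of `m` is at least `z`. -/
def psi (m : ℕ) (z : ℝ) : ℝ :=
  if ∀ p : ℕ, p.Prime → p ∣ m → z ≤ (p : ℝ) then 1 else 0

/-- The function `z(p)` of Harman–Kumchev. -/
def zfun (X : ℝ) (p : ℕ) : ℝ :=
  if (p : ℝ) < X ^ ((1 : ℝ) / 7) then X ^ ((5 : ℝ) / 28) * (p : ℝ) ^ (-(1 : ℝ) / 2)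
  else if (p : ℝ) ≤ X ^ ((3 : ℝ) / 14) then (p : ℝ)
  else X ^ ((5 : ℝ) / 14) * (p : ℝ)⁻¹

/-- The Harman–Kumchev sieve weight `ρ(m)`. -/
def rho (X : ℝ) (m : ℕ) : ℝ :=
  psi m (X ^ ((5 : ℝ) / 42)) -
    ∑ p ∈ (Finset.range (⌈X ^ ((1 : ℝ) / 4)⌉₊ + 1)).filter
        (fun p : ℕ => p.Prime ∧ X ^ ((5 : ℝ) / 42) ≤ (p : ℝ) ∧ (p : ℝ) < X ^ ((1 : ℝ) / 4) ∧ p ∣ m),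
      psi (m / p) (zfun X p)

/-- The sieved exponential sum `S̃_2(α)`. -/
def Stilde (δ X α : ℝ) : ℂ :=
  ∑ m ∈ (Finset.range (⌈X⌉₊ + 1)).filter
      (fun m : ℕ => δ * X ≤ (m : ℝ) ^ 2 ∧ (m : ℝ) ^ 2 ≤ X),
    (rho X m : ℂ) * e ((m : ℝ) ^ 2 * α)

/-- The Fejér-type kernel `K_η(α)`. -/
def Kf (η α : ℝ) : ℝ :=
  if α = 0 then η ^ 2 else (Real.sin (Real.pi * α * η) / (Real.pi * α)) ^ 2


/-- The integral `ℐ(η,ω,𝔛)`. -/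
def Ical (k δ l1 l2 l3 l4 η ω X : ℝ) (𝔛 : Set ℝ) : ℂ :=
  ∫ α in 𝔛, Stilde δ X (l1 * α) * S 2 δ X (l2 * α) * S 2 δ X (l3 * α) *
    S k δ X (l4 * α) * (Kf η α : ℂ) * e (-(ω * α))

/-- The Lorentzian weight `1 / (R ^ 2 + α ^ 2)`. -/
def lorentz (R α : ℝ) : ℝ := (R ^ 2 + α ^ 2)⁻¹

lemma lorentz_nonneg (R α : ℝ) : 0 ≤ lorentz R α := by
  unfold lorentz; positivity

lemma integrable_lorentz {R : ℝ} (hR : 0 < R) : Integrable (lorentz R) := by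
  have h := (integrable_inv_one_add_sq.comp_div hR.ne').const_mul (R ^ 2)⁻¹
  refine h.congr (Filter.Eventually.of_forall fun α => ?_)
  simp only [lorentz]
  rw [← mul_inv]
  congr 1
  field_simp

lemma norm_e (x : ℝ) : ‖e x‖ = 1 := by
  have := Complex.norm_exp_ofReal_mul_I (2 * Real.pi * x)
  unfold e
  rw [← this]
  congr 2
  push_cast
  ring

lemma e_add (x y : ℝ) : e (x + y) = e x * e y := by
  unfold e
  rw [← Complex.exp_add]
  congr 1
  push_cast
  ring

lemma conj_e (x : ℝ) : (starRingEnd ℂ) (e x) = e (-x) := by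
  unfold e
  rw [← Complex.exp_conj]
  congr 1
  simp only [map_mul, Complex.conj_ofReal, Complex.conj_I, Complex.ofReal_neg,
    map_ofNat]
  ring

lemma continuous_e : Continuous e := by
  unfold e
  fun_prop

lemma fourier_exp_neg_abs {R : ℝ} (hR : 0 < R) :
    Integrable (fun x : ℝ => (Real.exp (-(2 * Real.pi * R * |x|)) : ℂ)) ∧
    FourierTransform.fourier (fun x : ℝ => (Real.exp (-(2 * Real.pi * R * |x|)) : ℂ)) =
      fun w : ℝ => ((R / Real.pi * lorentz R w : ℝ) : ℂ) := by
  have hpi := Real.pi_pos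
  have hc : 0 < 2 * Real.pi * R := by positivity
  have key : ∀ w : ℝ,
      IntegrableOn (fun x : ℝ => Complex.exp (↑(-2 * Real.pi * x * w) * Complex.I) •
        (Real.exp (-(2 * Real.pi * R * |x|)) : ℂ)) (Set.Ioi 0) ∧
      IntegrableOn (fun x : ℝ => Complex.exp (↑(-2 * Real.pi * x * w) * Complex.I) •
        (Real.exp (-(2 * Real.pi * R * |x|)) : ℂ)) (Set.Iic 0) ∧
      ∫ x : ℝ, Complex.exp (↑(-2 * Real.pi * x * w) * Complex.I) •
        (Real.exp (-(2 * Real.pi * R * |x|)) : ℂ) = ((R / Real.pi * lorentz R w : ℝ) : ℂ) := by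
    intro w
    set a : ℂ := ((-(2 * Real.pi * R) : ℝ) : ℂ) + ((-2 * Real.pi * w : ℝ) : ℂ) * Complex.I
      with ha
    set b : ℂ := (((2 * Real.pi * R) : ℝ) : ℂ) + ((-2 * Real.pi * w : ℝ) : ℂ) * Complex.I
      with hb
    have har : a.re < 0 := by simp [ha]; positivity
    have hbr : 0 < b.re := by simp [hb]; positivity
    have e1 : Set.EqOn (fun x : ℝ => Complex.exp (a * x))
        (fun x : ℝ => Complex.exp (↑(-2 * Real.pi * x * w) * Complex.I) •
        (Real.exp (-(2 * Real.pi * R * |x|)) : ℂ)) (Set.Ioi 0) := by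
      intro x hx
      simp only [smul_eq_mul]
      rw [abs_of_pos (show 0 < x from hx), Complex.ofReal_exp, ← Complex.exp_add]
      congr 1
      simp only [ha]; push_cast; ring
    have e2 : Set.EqOn (fun x : ℝ => Complex.exp (b * x))
        (fun x : ℝ => Complex.exp (↑(-2 * Real.pi * x * w) * Complex.I) •
        (Real.exp (-(2 * Real.pi * R * |x|)) : ℂ)) (Set.Iic 0) := by
      intro x hx
      simp only [smul_eq_mul]
      rw [abs_of_nonpos (show x ≤ 0 from hx), Complex.ofReal_exp, ← Complex.exp_add]
      congr 1
      simp only [hb]; push_cast; ring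
    have i1 := (integrableOn_exp_mul_complex_Ioi har 0).congr_fun e1 measurableSet_Ioi
    have i2 := (integrableOn_exp_mul_complex_Iic hbr 0).congr_fun e2 measurableSet_Iic
    refine ⟨i1, i2, ?_⟩
    rw [← intervalIntegral.integral_Iic_add_Ioi i2 i1, ← setIntegral_congr_fun measurableSet_Ioi e1,
      ← setIntegral_congr_fun measurableSet_Iic e2, integral_exp_mul_complex_Ioi har,
      integral_exp_mul_complex_Iic hbr]
    have ha0 : a ≠ 0 := fun h => by simp [h] at har
    have hb0 : b ≠ 0 := fun h => by simp [h] at hbr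
    have hab : a * b = ((-(4 * Real.pi ^ 2 * (R ^ 2 + w ^ 2)) : ℝ) : ℂ) := by
      simp only [ha, hb]
      push_cast
      linear_combination (4 * (Real.pi : ℂ) ^ 2 * w ^ 2) * Complex.I_sq
    have hba : a - b = ((-(4 * Real.pi * R) : ℝ) : ℂ) := by
      simp only [ha, hb]
      push_cast
      ring
    have : Complex.exp (b * ((0 : ℝ) : ℂ)) / b + -Complex.exp (a * ((0 : ℝ) : ℂ)) / a =
        (a - b) / (a * b) := by
      simp
      field_simp
      ring
    rw [this, hab, hba, ← Complex.ofReal_div]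
    congr 1
    unfold lorentz
    have : R ^ 2 + w ^ 2 ≠ 0 := by positivity
    field_simp
  constructor
  · obtain ⟨h1, h2, -⟩ := key 0
    have := h2.union h1
    rw [Set.Iic_union_Ioi, integrableOn_univ] at this
    simpa using this
  · funext w
    rw [Real.fourier_real_eq_integral_exp_smul]
    exact (key w).2.2

lemma integral_e_mul_lorentz {R : ℝ} (hR : 0 < R) (x : ℝ) :
    ∫ α : ℝ, e (x * α) * (lorentz R α : ℂ) =
      ((Real.pi / R * Real.exp (-(2 * Real.pi * R * |x|)) : ℝ) : ℂ) := by
  obtain ⟨h1, h2⟩ := fourier_exp_neg_abs hR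
  have hpi := Real.pi_pos
  have h3 := Continuous.fourierInv_fourier_eq (by fun_prop) h1
    (by rw [h2]; exact ((integrable_lorentz hR).const_mul _).ofReal)
  rw [h2] at h3
  have h4 := congrFun h3 x
  rw [Real.fourierInv_eq'] at h4
  have h5 : ∫ α : ℝ, e (x * α) * (lorentz R α : ℂ) = ((Real.pi / R : ℝ) : ℂ) *
      ∫ v : ℝ, Complex.exp (↑(2 * Real.pi * inner ℝ v x) * Complex.I) •
        ((R / Real.pi * lorentz R v : ℝ) : ℂ) := by
    rw [← integral_const_mul]
    congr 1
    funext α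
    have : (Real.pi : ℂ) ≠ 0 := by exact_mod_cast hpi.ne'
    have : (R : ℂ) ≠ 0 := by exact_mod_cast hR.ne'
    have h6 : e (x * α) = Complex.exp (↑(2 * Real.pi * inner ℝ α x) * Complex.I) := by
      unfold e
      congr 1
      simp
      ring
    rw [h6]
    push_cast [smul_eq_mul]
    field_simp
  rw [h5, h4]
  push_cast
  rfl

lemma integrable_mul_lorentz {E : Type*} [NormedRing E] [NormedAlgebra ℝ E] {R : ℝ} (hR : 0 < R)
    {g : ℝ → E} (hg : Continuous g) {B : ℝ} (hB : ∀ α, ‖g α‖ ≤ B) :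
    Integrable (fun α => lorentz R α • g α) :=
  (integrable_lorentz hR).smul_bdd B hg.aestronglyMeasurable (Filter.Eventually.of_forall hB)

lemma sum_half_pow_dist_le (s : Finset ℕ) (n : ℕ) :
    ∑ m ∈ s, (1 / 2 : ℝ) ^ (Nat.dist n m) ≤ 4 := by
  obtain ⟨N, hN⟩ := s.exists_nat_subset_range
  have h : s ⊆ Finset.range (n + 1) ∪ Finset.Ico n (n + N) := by
    intro m hm
    have := hN hm
    simp at this ⊢
    omega
  have hg : ∀ M : ℕ, ∑ i ∈ Finset.range M, (1 / 2 : ℝ) ^ i ≤ 2 := by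
    intro M
    exact sum_geometric_two_le M
  calc ∑ m ∈ s, (1 / 2 : ℝ) ^ (Nat.dist n m)
      ≤ ∑ m ∈ Finset.range (n + 1) ∪ Finset.Ico n (n + N), (1 / 2 : ℝ) ^ (Nat.dist n m) :=
        Finset.sum_le_sum_of_subset_of_nonneg h fun _ _ _ => by positivity
    _ ≤ ∑ m ∈ Finset.range (n + 1), (1 / 2 : ℝ) ^ (Nat.dist n m) +
        ∑ m ∈ Finset.Ico n (n + N), (1 / 2 : ℝ) ^ (Nat.dist n m) := by
        rw [← Finset.sum_union_inter]
        exact le_add_of_nonneg_right (Finset.sum_nonneg fun _ _ => by positivity)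
    _ = ∑ i ∈ Finset.range (n + 1), (1 / 2 : ℝ) ^ i + ∑ i ∈ Finset.range N, (1 / 2 : ℝ) ^ i := by
        congr 1
        · rw [← Finset.sum_range_reflect]
          refine Finset.sum_congr rfl fun m hm => ?_
          rw [Nat.dist_eq_sub_of_le_right (by simp at hm; omega)]
          congr 1
          simp at hm
          omega
        · rw [Finset.sum_Ico_eq_sum_range]
          simp [Nat.dist]
    _ ≤ 2 + 2 := add_le_add (hg _) (hg _)
    _ = 4 := by norm_num

/-- The finite exponential sum `∑ a n e(ν n α)`. -/
def expSum {ι : Type*} (s : Finset ι) (ν : ι → ℝ) (a : ι → ℂ) (α : ℝ) : ℂ :=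
  ∑ n ∈ s, a n * e (ν n * α)

lemma continuous_expSum {ι : Type*} (s : Finset ι) (ν : ι → ℝ) (a : ι → ℂ) :
    Continuous (expSum s ν a) := by
  unfold expSum
  exact continuous_finsetSum _ fun n _ =>
    continuous_const.mul (continuous_e.comp (continuous_const.mul continuous_id))

lemma norm_expSum_le {ι : Type*} (s : Finset ι) (ν : ι → ℝ) (a : ι → ℂ) (α : ℝ) :
    ‖expSum s ν a α‖ ≤ ∑ n ∈ s, ‖a n‖ := by
  unfold expSum
  refine (norm_sum_le _ _).trans (le_of_eq ?_)
  simp [norm_e]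

lemma integrable_lorentz_mul_expSum_pow {ι : Type*} (s : Finset ι) (ν : ι → ℝ) (a : ι → ℂ)
    {R : ℝ} (hR : 0 < R) (l : ℝ) (j : ℕ) :
    Integrable (fun α => lorentz R α * ‖expSum s ν a (l * α)‖ ^ j) := by
  refine integrable_mul_lorentz hR (g := fun α => ‖expSum s ν a (l * α)‖ ^ j)
    (B := (∑ n ∈ s, ‖a n‖) ^ j) ?_ ?_
  · exact (((continuous_expSum s ν a).comp (continuous_const.mul continuous_id)).norm.pow j)
  · intro α
    rw [norm_pow, norm_norm]
    exact pow_le_pow_left₀ (norm_nonneg _) (norm_expSum_le _ _ _ _) _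

lemma integral_lorentz_mul_expSum_sq {ι : Type*} (s : Finset ι) (ν : ι → ℝ) (a : ι → ℂ)
    {R : ℝ} (hR : 0 < R) (l : ℝ) :
    ((∫ α, lorentz R α * ‖expSum s ν a (l * α)‖ ^ 2 : ℝ) : ℂ) =
      ∑ n ∈ s, ∑ m ∈ s, a n * (starRingEnd ℂ) (a m) *
        ((Real.pi / R * Real.exp (-(2 * Real.pi * R * |(ν n - ν m) * l|)) : ℝ) : ℂ) := by
  have h : ∀ α : ℝ, ((lorentz R α * ‖expSum s ν a (l * α)‖ ^ 2 : ℝ) : ℂ) =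
      ∑ n ∈ s, ∑ m ∈ s, a n * (starRingEnd ℂ) (a m) *
        (e ((ν n - ν m) * l * α) * (lorentz R α : ℂ)) := by
    intro α
    push_cast
    rw [← Complex.mul_conj', expSum, map_sum, Finset.sum_mul_sum, Finset.mul_sum]
    refine Finset.sum_congr rfl fun n _ => ?_
    rw [Finset.mul_sum]
    refine Finset.sum_congr rfl fun m _ => ?_
    rw [map_mul, conj_e, show (ν n - ν m) * l * α = ν n * (l * α) + -(ν m * (l * α)) by ring,
      e_add]
    ring
  have hInt : ∀ x : ℝ, Integrable (fun α : ℝ => e (x * α) * (lorentz R α : ℂ)) := by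
    intro x
    have := integrable_mul_lorentz hR (g := fun α => e (x * α)) (B := 1)
      (continuous_e.comp (continuous_const.mul continuous_id)) (fun α => (norm_e _).le)
    refine this.congr (Filter.Eventually.of_forall fun α => ?_)
    simp [mul_comm]
  rw [← integral_complex_ofReal]
  simp_rw [h]
  rw [integral_finsetSum _ fun n _ => integrable_finsetSum _ fun m _ => (hInt _).const_mul _]
  refine Finset.sum_congr rfl fun n _ => ?_
  rw [integral_finsetSum _ fun m _ => (hInt _).const_mul _]
  refine Finset.sum_congr rfl fun m _ => ?_
  rw [integral_const_mul, integral_e_mul_lorentz hR]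

lemma integral_lorentz_mul_expSum_sq_le (s : Finset ℕ) (ν : ℕ → ℝ) (a : ℕ → ℂ)
    (hν : ∀ n ∈ s, ∀ m ∈ s, |(n : ℝ) - m| ≤ |ν n - ν m|)
    {R l : ℝ} (hR : 0 < R) (hl : 2 ≤ R * |l|) :
    ∫ α, lorentz R α * ‖expSum s ν a (l * α)‖ ^ 2 ≤
      4 * Real.pi / R * ∑ n ∈ s, ‖a n‖ ^ 2 := by
  have hpi := Real.pi_pos
  have hdist : ∀ n m : ℕ, |(n : ℝ) - m| = (Nat.dist n m : ℝ) := by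
    intro n m
    rcases le_total n m with h | h
    · rw [Nat.dist_eq_sub_of_le h, Nat.cast_sub h, abs_sub_comm, abs_of_nonneg]
      simpa using h
    · rw [Nat.dist_eq_sub_of_le_right h, Nat.cast_sub h, abs_of_nonneg]
      simpa using h
  have hexp : ∀ n ∈ s, ∀ m ∈ s, Real.exp (-(2 * Real.pi * R * |(ν n - ν m) * l|)) ≤
      (1 / 2 : ℝ) ^ (Nat.dist n m) := by
    intro n hn m hm
    have h1 : (Nat.dist n m : ℝ) ≤ 2 * Real.pi * R * |(ν n - ν m) * l| := by
      rw [← hdist, abs_mul]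
      have h3 := Real.pi_gt_three
      calc |(n : ℝ) - m| ≤ |ν n - ν m| * 1 := by simpa using hν n hn m hm
        _ ≤ |ν n - ν m| * (2 * Real.pi * (R * |l|)) := by
            gcongr
            nlinarith
        _ = _ := by ring
    calc Real.exp (-(2 * Real.pi * R * |(ν n - ν m) * l|)) ≤ Real.exp (-(Nat.dist n m : ℝ)) :=
          Real.exp_le_exp.mpr (neg_le_neg h1)
      _ = (Real.exp (-1)) ^ (Nat.dist n m) := by
          rw [← Real.exp_nat_mul]; congr 1; ring
      _ ≤ (1 / 2 : ℝ) ^ (Nat.dist n m) := by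
          gcongr
          rw [Real.exp_neg, one_div]
          gcongr
          have := Real.add_one_le_exp (1 : ℝ)
          linarith
  have h0 := integral_lorentz_mul_expSum_sq s ν a hR l
  have h1 := congrArg norm h0
  rw [Complex.norm_real] at h1
  calc ∫ α, lorentz R α * ‖expSum s ν a (l * α)‖ ^ 2
      ≤ ‖∫ α, lorentz R α * ‖expSum s ν a (l * α)‖ ^ 2‖ := Real.le_norm_self _
    _ ≤ ∑ n ∈ s, ∑ m ∈ s, ((‖a n‖ ^ 2 + ‖a m‖ ^ 2) / 2) * (Real.pi / R *
          (1 / 2 : ℝ) ^ (Nat.dist n m)) := by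
        rw [h1]
        refine (norm_sum_le _ _).trans (Finset.sum_le_sum fun n hn => ?_)
        refine (norm_sum_le _ _).trans (Finset.sum_le_sum fun m hm => ?_)
        rw [norm_mul, norm_mul, RCLike.norm_conj, Complex.norm_real,
          Real.norm_of_nonneg (by positivity)]
        gcongr
        · nlinarith [sq_nonneg (‖a n‖ - ‖a m‖)]
        · exact hexp n hn m hm
    _ = Real.pi / R * ∑ n ∈ s, ‖a n‖ ^ 2 * ∑ m ∈ s, (1 / 2 : ℝ) ^ (Nat.dist n m) := by
        have hsym : ∑ n ∈ s, ∑ m ∈ s, ‖a m‖ ^ 2 * (1 / 2 : ℝ) ^ (Nat.dist n m) =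
            ∑ n ∈ s, ∑ m ∈ s, ‖a n‖ ^ 2 * (1 / 2 : ℝ) ^ (Nat.dist n m) := by
          rw [Finset.sum_comm]
          simp_rw [Nat.dist_comm]
        have : ∀ n m : ℕ, ((‖a n‖ ^ 2 + ‖a m‖ ^ 2) / 2) * (Real.pi / R *
          (1 / 2 : ℝ) ^ (Nat.dist n m)) = Real.pi / R / 2 * (‖a n‖ ^ 2 *
          (1 / 2 : ℝ) ^ (Nat.dist n m)) + Real.pi / R / 2 * (‖a m‖ ^ 2 *
          (1 / 2 : ℝ) ^ (Nat.dist n m)) := by intros; ring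
        simp_rw [this, Finset.sum_add_distrib, ← Finset.mul_sum, hsym, Finset.mul_sum]
        rw [← Finset.sum_add_distrib]
        refine Finset.sum_congr rfl fun n _ => ?_
        rw [← Finset.sum_add_distrib]
        refine Finset.sum_congr rfl fun m _ => ?_
        ring
    _ ≤ Real.pi / R * ∑ n ∈ s, ‖a n‖ ^ 2 * 4 := by
        gcongr with n hn
        exact sum_half_pow_dist_le s n
    _ = 4 * Real.pi / R * ∑ n ∈ s, ‖a n‖ ^ 2 := by
        rw [← Finset.sum_mul]; ring

lemma integral_lorentz_mul_expSum_sq_four_le (s : Finset ℕ) (a : ℕ → ℂ) {A : ℝ}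
    (ha : ∀ n ∈ s, ‖a n‖ ≤ A) {R l : ℝ} (hR : 0 < R) (hl : 2 ≤ R * |l|) :
    ∫ α, lorentz R α * ‖expSum s (fun n => (n : ℝ) ^ 2) a (l * α)‖ ^ 4 ≤
      4 * Real.pi / R * (A ^ 4 * (((s ×ˢ s) ×ˢ (s ×ˢ s)).filter fun x : (ℕ × ℕ) × (ℕ × ℕ) =>
        x.1.1 ^ 2 + x.1.2 ^ 2 = x.2.1 ^ 2 + x.2.2 ^ 2).card) := by
  set f : ℕ × ℕ → ℕ := fun p => p.1 ^ 2 + p.2 ^ 2 with hf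
  set t : Finset ℕ := (s ×ˢ s).image f with ht
  set F : ℕ → Finset (ℕ × ℕ) := fun v => (s ×ˢ s).filter fun p => f p = v with hF
  set b : ℕ → ℂ := fun v => ∑ p ∈ F v, a p.1 * a p.2 with hb
  have hmaps : ∀ p ∈ s ×ˢ s, f p ∈ t := fun p hp => Finset.mem_image_of_mem _ hp
  have hsq : ∀ β : ℝ, expSum s (fun n => (n : ℝ) ^ 2) a β ^ 2 =
      expSum t (fun n => (n : ℝ)) b β := by
    intro β
    unfold expSum
    rw [sq, Finset.sum_mul_sum, ← Finset.sum_product', ← Finset.sum_fiberwise_of_maps_to hmaps]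
    refine Finset.sum_congr rfl fun v _ => ?_
    rw [hb, Finset.sum_mul]
    refine Finset.sum_congr rfl fun p hp => ?_
    have hp2 : f p = v := (Finset.mem_filter.mp hp).2
    rw [← hp2, hf]
    push_cast
    rw [add_mul, e_add]
    ring
  have hbn : ∀ v, ‖b v‖ ≤ (F v).card * A ^ 2 := by
    intro v
    rw [← nsmul_eq_mul]
    refine (norm_sum_le _ _).trans (Finset.sum_le_card_nsmul _ _ _ fun p hp => ?_)
    have hp1 := Finset.mem_product.mp (Finset.mem_filter.mp hp).1
    rw [norm_mul, sq]
    exact mul_le_mul (ha _ hp1.1) (ha _ hp1.2) (norm_nonneg _)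
      ((norm_nonneg _).trans (ha _ hp1.1))
  have hcard : (((s ×ˢ s) ×ˢ (s ×ˢ s)).filter fun x : (ℕ × ℕ) × (ℕ × ℕ) =>
        x.1.1 ^ 2 + x.1.2 ^ 2 = x.2.1 ^ 2 + x.2.2 ^ 2).card = ∑ v ∈ t, (F v).card ^ 2 := by
    rw [Finset.card_eq_sum_card_fiberwise (f := fun x => f x.1) (t := t)]
    · refine Finset.sum_congr rfl fun v _ => ?_
      rw [sq, ← Finset.card_product]
      congr 1
      ext x
      simp only [hF, hf, Finset.mem_filter, Finset.mem_product]
      constructor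
      · rintro ⟨⟨⟨h1, h2⟩, h3⟩, h4⟩
        exact ⟨⟨h1, h4⟩, h2, by omega⟩
      · rintro ⟨⟨h1, h4⟩, h2, h3⟩
        exact ⟨⟨⟨h1, h2⟩, by omega⟩, h4⟩
    · intro x hx
      simp only [Finset.coe_filter, Finset.mem_product, Set.mem_ofPred_eq] at hx
      exact hmaps _ (Finset.mem_product.mpr hx.1.1)
  have h1 := integral_lorentz_mul_expSum_sq_le t (fun n => (n : ℝ)) b
    (fun _ _ _ _ => le_rfl) hR hl
  have h2 : ∀ α : ℝ, ‖expSum s (fun n => (n : ℝ) ^ 2) a (l * α)‖ ^ 4 =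
      ‖expSum t (fun n => (n : ℝ)) b (l * α)‖ ^ 2 := by
    intro α
    rw [← hsq, norm_pow, ← pow_mul]
  simp_rw [h2]
  refine h1.trans ?_
  have hpi := Real.pi_pos
  gcongr
  rw [hcard]
  push_cast
  rw [Finset.mul_sum]
  refine Finset.sum_le_sum fun v _ => ?_
  calc ‖b v‖ ^ 2 ≤ ((F v).card * A ^ 2) ^ 2 := by gcongr; exact hbn v
    _ = A ^ 4 * ((F v).card : ℝ) ^ 2 := by ring

/-- The number of solutions of `x * y = z * w` with all variables in `[1, M]`. -/
def mulSolutions (M : ℕ) : Finset ((ℕ × ℕ) × (ℕ × ℕ)) :=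
  ((Finset.Icc 1 M ×ˢ Finset.Icc 1 M) ×ˢ (Finset.Icc 1 M ×ˢ Finset.Icc 1 M)).filter
    fun x => x.1.1 * x.1.2 = x.2.1 * x.2.2

lemma card_mulSolutions_le_sum (M : ℕ) :
    (mulSolutions M).card ≤
      ∑ p ∈ Finset.Icc 1 M ×ˢ Finset.Icc 1 M, (M / max p.1 p.2) ^ 2 := by
  set P : Finset (Σ _ : ℕ × ℕ, ℕ × ℕ) := (Finset.Icc 1 M ×ˢ Finset.Icc 1 M).sigma fun p =>
    Finset.Icc 1 (M / max p.1 p.2) ×ˢ Finset.Icc 1 (M / max p.1 p.2) with hP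
  have hcard : P.card = ∑ p ∈ Finset.Icc 1 M ×ˢ Finset.Icc 1 M, (M / max p.1 p.2) ^ 2 := by
    rw [hP, Finset.card_sigma]
    refine Finset.sum_congr rfl fun p _ => ?_
    simp [sq]
  rw [← hcard]
  refine Finset.card_le_card_of_surjOn
    (fun q => ((q.2.1 * q.1.1, q.1.2 * q.2.2), (q.2.1 * q.1.2, q.1.1 * q.2.2))) ?_
  rintro ⟨⟨x, y⟩, ⟨z, w⟩⟩ hx
  simp only [mulSolutions, Finset.coe_filter, Finset.mem_product, Finset.mem_Icc,
    Set.mem_ofPred_eq] at hx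
  obtain ⟨⟨⟨⟨hx1, hxM⟩, ⟨hy1, hyM⟩⟩, ⟨hz1, hzM⟩, hw1, hwM⟩, heq⟩ := hx
  obtain ⟨g, s, t, hg, hcop, hxs, hzt⟩ := Nat.exists_coprime' (m := x) (n := z)
    (Nat.gcd_pos_of_pos_left _ hx1)
  subst hxs hzt
  have hs : 0 < s := Nat.pos_of_mul_pos_right hx1
  have ht : 0 < t := Nat.pos_of_mul_pos_right hz1
  have heq2 : s * y = t * w := by
    apply Nat.eq_of_mul_eq_mul_left hg
    linarith
  obtain ⟨h, rfl⟩ : t ∣ y := hcop.symm.dvd_of_dvd_mul_left ⟨w, heq2⟩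
  have hw : w = s * h := by
    apply Nat.eq_of_mul_eq_mul_left ht
    linarith
  subst hw
  have hh : 0 < h := Nat.pos_of_mul_pos_left hy1
  refine ⟨⟨(s, t), (g, h)⟩, ?_, ?_⟩
  · simp only [hP, Finset.coe_sigma, Set.mem_sigma_iff, Finset.mem_coe, Finset.mem_product,
      Finset.mem_Icc]
    have hmax : 0 < max s t := lt_max_of_lt_left hs
    refine ⟨⟨⟨hs, ?_⟩, ht, ?_⟩, ⟨hg, ?_⟩, hh, ?_⟩
    · nlinarith
    · nlinarith
    · rw [Nat.le_div_iff_mul_le hmax]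
      rcases max_cases s t with ⟨h', _⟩ | ⟨h', _⟩ <;> rw [h'] <;> linarith
    · rw [Nat.le_div_iff_mul_le hmax]
      rcases max_cases s t with ⟨h', _⟩ | ⟨h', _⟩ <;> rw [h'] <;> linarith
  · simp [mul_comm]

lemma card_mulSolutions_le (M : ℕ) :
    ((mulSolutions M).card : ℝ) ≤ 2 * M ^ 2 * (1 + Real.log M) := by
  have h1 : ((mulSolutions M).card : ℝ) ≤
      ∑ p ∈ Finset.Icc 1 M ×ˢ Finset.Icc 1 M, ((M / max p.1 p.2 : ℕ) : ℝ) ^ 2 := by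
    exact_mod_cast card_mulSolutions_le_sum M
  have h2 : ∀ p ∈ Finset.Icc 1 M ×ˢ Finset.Icc 1 M, ((M / max p.1 p.2 : ℕ) : ℝ) ^ 2 ≤
      (if p.2 ≤ p.1 then (M : ℝ) ^ 2 / (p.1 : ℝ) ^ 2 else 0) +
      (if p.1 ≤ p.2 then (M : ℝ) ^ 2 / (p.2 : ℝ) ^ 2 else 0) := by
    rintro ⟨s, t⟩ _
    have hdiv : ∀ r : ℕ, ((M / r : ℕ) : ℝ) ^ 2 ≤ (M : ℝ) ^ 2 / (r : ℝ) ^ 2 := by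
      intro r
      rw [← div_pow]
      gcongr
      exact Nat.cast_div_le
    rcases le_total s t with h | h
    · simp only [max_eq_right h, if_pos h]
      refine (hdiv t).trans (le_add_of_nonneg_left ?_)
      split_ifs <;> positivity
    · simp only [max_eq_left h, if_pos h]
      refine (hdiv s).trans (le_add_of_nonneg_right ?_)
      split_ifs <;> positivity
  have h3 : ∀ s ∈ Finset.Icc 1 M, ∑ t ∈ Finset.Icc 1 M,
      (if t ≤ s then (M : ℝ) ^ 2 / (s : ℝ) ^ 2 else 0) = (M : ℝ) ^ 2 * (s : ℝ)⁻¹ := by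
    intro s hs
    rw [Finset.mem_Icc] at hs
    rw [← Finset.sum_filter, Finset.sum_const]
    have : (Finset.Icc 1 M).filter (fun t => t ≤ s) = Finset.Icc 1 s := by
      ext t; simp; omega
    rw [this]
    have hs0 : (s : ℝ) ≠ 0 := by
      have : s ≠ 0 := by omega
      exact_mod_cast this
    simp
    field_simp
  have hH : ∑ s ∈ Finset.Icc 1 M, ((s : ℝ))⁻¹ ≤ 1 + Real.log M := by
    have := harmonic_le_one_add_log M
    rw [harmonic_eq_sum_Icc] at this
    push_cast at this
    exact this
  calc ((mulSolutions M).card : ℝ) ≤ _ := h1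
    _ ≤ _ := Finset.sum_le_sum h2
    _ = 2 * ((M : ℝ) ^ 2 * ∑ s ∈ Finset.Icc 1 M, ((s : ℝ))⁻¹) := by
        rw [Finset.sum_add_distrib, Finset.sum_product, Finset.sum_product_right,
          Finset.sum_congr rfl h3, ← Finset.mul_sum]
        ring
    _ ≤ 2 * ((M : ℝ) ^ 2 * (1 + Real.log M)) := by gcongr
    _ = _ := by ring

lemma card_sq_add_sq_eq_le (s : Finset ℕ) (N : ℕ) (hs : s ⊆ Finset.Icc 1 N) :
    ((((s ×ˢ s) ×ˢ (s ×ˢ s)).filter fun x : (ℕ × ℕ) × (ℕ × ℕ) =>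
        x.1.1 ^ 2 + x.1.2 ^ 2 = x.2.1 ^ 2 + x.2.2 ^ 2).card : ℝ) ≤
      N ^ 2 + 2 * (mulSolutions (2 * N)).card := by
  set Q := ((s ×ˢ s) ×ˢ (s ×ˢ s)).filter fun x : (ℕ × ℕ) × (ℕ × ℕ) =>
        x.1.1 ^ 2 + x.1.2 ^ 2 = x.2.1 ^ 2 + x.2.2 ^ 2 with hQ
  have hmem : ∀ x ∈ Q, (1 ≤ x.1.1 ∧ x.1.1 ≤ N) ∧ (1 ≤ x.1.2 ∧ x.1.2 ≤ N) ∧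
      (1 ≤ x.2.1 ∧ x.2.1 ≤ N) ∧ (1 ≤ x.2.2 ∧ x.2.2 ≤ N) ∧
      x.1.1 ^ 2 + x.1.2 ^ 2 = x.2.1 ^ 2 + x.2.2 ^ 2 := by
    intro x hx
    simp only [hQ, Finset.mem_filter, Finset.mem_product] at hx
    obtain ⟨⟨⟨h1, h2⟩, h3, h4⟩, h5⟩ := hx
    exact ⟨Finset.mem_Icc.mp (hs h1), Finset.mem_Icc.mp (hs h2), Finset.mem_Icc.mp (hs h3),
      Finset.mem_Icc.mp (hs h4), h5⟩
  have hdiag : (Q.filter fun x => x.1.1 = x.2.1).card ≤ N ^ 2 := by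
    have : N ^ 2 = (Finset.Icc 1 N ×ˢ Finset.Icc 1 N).card := by simp [sq]
    rw [this]
    refine Finset.card_le_card_of_injOn (fun x => x.1) ?_ ?_
    · intro x hx
      obtain ⟨h1, h2, -⟩ := hmem x (Finset.mem_filter.mp hx).1
      simp only [Finset.coe_product, Set.mem_prod, Finset.mem_coe, Finset.mem_Icc]
      exact ⟨h1, h2⟩
    · rintro ⟨⟨a, b⟩, c, d⟩ hx ⟨⟨a', b'⟩, c', d'⟩ hx' h
      have hx0 := (hmem _ (Finset.mem_filter.mp hx).1).2.2.2.2
      have hx0' := (hmem _ (Finset.mem_filter.mp hx').1).2.2.2.2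
      have hx1 := (Finset.mem_filter.mp hx).2
      have hx1' := (Finset.mem_filter.mp hx').2
      simp only [Prod.mk.injEq] at h hx0 hx0' hx1 hx1' ⊢
      obtain ⟨rfl, rfl⟩ := h
      subst hx1 hx1'
      have h1 : b ^ 2 = d ^ 2 := by omega
      have h2 : b ^ 2 = d' ^ 2 := by omega
      have h3 : b = d := Nat.pow_left_injective (by norm_num : 2 ≠ 0) h1
      have h4 : b = d' := Nat.pow_left_injective (by norm_num : 2 ≠ 0) h2
      exact ⟨⟨rfl, rfl⟩, rfl, h3 ▸ h4⟩
  have hgt : (Q.filter fun x => x.2.1 < x.1.1).card ≤ (mulSolutions (2 * N)).card := by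
    refine Finset.card_le_card_of_injOn
      (fun x => ((x.1.1 - x.2.1, x.1.1 + x.2.1), (x.2.2 - x.1.2, x.2.2 + x.1.2))) ?_ ?_
    · rintro ⟨⟨a, b⟩, c, d⟩ hx
      obtain ⟨h1, h2, h3, h4, h5⟩ := hmem _ (Finset.mem_filter.mp hx).1
      have h6 := (Finset.mem_filter.mp hx).2
      simp only at h1 h2 h3 h4 h5 h6
      have h7 : b < d := by nlinarith
      simp only [mulSolutions, Finset.coe_filter, Finset.mem_product, Finset.mem_Icc,
        Set.mem_ofPred_eq]
      refine ⟨⟨⟨⟨?_, ?_⟩, ?_, ?_⟩, ⟨?_, ?_⟩, ?_, ?_⟩, ?_⟩ <;> try omega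
      zify [h6.le, h7.le]
      zify at h5
      linarith
    · rintro ⟨⟨a, b⟩, c, d⟩ hx ⟨⟨a', b'⟩, c', d'⟩ hx' h
      have h5 := (hmem _ (Finset.mem_filter.mp hx).1).2.2.2.2
      have h5' := (hmem _ (Finset.mem_filter.mp hx').1).2.2.2.2
      have h6 := (Finset.mem_filter.mp hx).2
      have h6' := (Finset.mem_filter.mp hx').2
      simp only at h5 h6 h5' h6'
      have h7 : b < d := by nlinarith
      have h7' : b' < d' := by nlinarith
      simp only [Prod.mk.injEq] at h ⊢
      omega
  have hlt : (Q.filter fun x => x.1.1 < x.2.1).card ≤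
      (Q.filter fun x => x.2.1 < x.1.1).card := by
    refine Finset.card_le_card_of_injOn (fun x => (x.2, x.1)) ?_ ?_
    · intro x hx
      simp only [hQ, Finset.coe_filter, Finset.mem_filter, Finset.mem_product,
        Set.mem_ofPred_eq] at hx ⊢
      exact ⟨⟨⟨hx.1.1.2, hx.1.1.1⟩, hx.1.2.symm⟩, hx.2⟩
    · intro x _ y _ h
      simp only [Prod.mk.injEq] at h
      exact Prod.ext h.2 h.1
  have hsub : Q ⊆ (Q.filter fun x => x.1.1 = x.2.1) ∪ (Q.filter fun x => x.2.1 < x.1.1) ∪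
      (Q.filter fun x => x.1.1 < x.2.1) := by
    intro x hx
    simp only [Finset.mem_union, Finset.mem_filter, hx, true_and]
    omega
  have h := (Finset.card_le_card hsub).trans
    ((Finset.card_union_le _ _).trans (Nat.add_le_add_right (Finset.card_union_le _ _) _))
  have : Q.card ≤ N ^ 2 + 2 * (mulSolutions (2 * N)).card := by omega
  exact_mod_cast this

lemma psi_nonneg (m : ℕ) (z : ℝ) : 0 ≤ psi m z := by
  unfold psi
  split_ifs <;> norm_num

lemma psi_le_one (m : ℕ) (z : ℝ) : psi m z ≤ 1 := by
  unfold psi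
  split_ifs <;> norm_num

lemma abs_rho_le {X : ℝ} (hX : 1 < X) {m : ℕ} (hm : 1 ≤ m) (hmX : (m : ℝ) ^ 2 ≤ X) :
    |rho X m| ≤ 4 := by
  unfold rho
  set T := (Finset.range (⌈X ^ ((1 : ℝ) / 4)⌉₊ + 1)).filter
        (fun p : ℕ => p.Prime ∧ X ^ ((5 : ℝ) / 42) ≤ (p : ℝ) ∧ (p : ℝ) < X ^ ((1 : ℝ) / 4) ∧ p ∣ m)
    with hT
  have hX0 : 0 < X := by linarith
  have hprops : ∀ p ∈ T, p.Prime ∧ X ^ ((5 : ℝ) / 42) ≤ (p : ℝ) ∧ p ∣ m := by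
    intro p hp
    obtain ⟨-, h1, h2, -, h4⟩ := Finset.mem_filter.mp hp
    exact ⟨h1, h2, h4⟩
  have hcard : T.card ≤ 4 := by
    have hdvd : ∏ p ∈ T, p ∣ m :=
      Finset.prod_primes_dvd m (fun p hp => (hprops p hp).1.prime) fun p hp => (hprops p hp).2.2
    have h1 : ((∏ p ∈ T, p : ℕ) : ℝ) ≤ m := by exact_mod_cast Nat.le_of_dvd hm hdvd
    have h2 : (X ^ ((5 : ℝ) / 42)) ^ T.card ≤ ((∏ p ∈ T, p : ℕ) : ℝ) := by
      rw [Nat.cast_prod, ← Finset.prod_const]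
      exact Finset.prod_le_prod (fun _ _ => by positivity) fun p hp => (hprops p hp).2.1
    have h3 : ((X ^ ((5 : ℝ) / 42)) ^ T.card) ^ 2 ≤ X ^ (1 : ℝ) := by
      rw [Real.rpow_one]
      exact (pow_le_pow_left₀ (by positivity) (h2.trans h1) 2).trans hmX
    rw [← pow_mul, ← Real.rpow_natCast, ← Real.rpow_mul hX0.le,
      Real.rpow_le_rpow_left_iff hX] at h3
    push_cast at h3
    have h4 : (T.card : ℝ) < 5 := by linarith
    have h5 : T.card < 5 := by exact_mod_cast h4
    omega
  have hs0 : 0 ≤ ∑ p ∈ T, psi (m / p) (zfun X p) := Finset.sum_nonneg fun _ _ => psi_nonneg _ _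
  have hs1 : ∑ p ∈ T, psi (m / p) (zfun X p) ≤ 4 := by
    refine (Finset.sum_le_card_nsmul _ _ 1 fun _ _ => psi_le_one _ _).trans ?_
    simpa using! (by exact_mod_cast hcard : (T.card : ℝ) ≤ 4)
  have h0 := psi_nonneg m (X ^ ((5 : ℝ) / 42))
  have h1 := psi_le_one m (X ^ ((5 : ℝ) / 42))
  rw [abs_le]
  constructor <;> linarith

lemma integral_lorentz_mul_expSum_sq_four_le_log {X : ℝ} (hX : 2 ≤ X) (s : Finset ℕ) (a : ℕ → ℂ)
    {A : ℝ} (hs : ∀ n ∈ s, 1 ≤ n ∧ (n : ℝ) ^ 2 ≤ X) (ha : ∀ n ∈ s, ‖a n‖ ≤ A)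
    {R l : ℝ} (hR : 0 < R) (hl : 2 ≤ R * |l|) :
    ∫ α, lorentz R α * ‖expSum s (fun n => (n : ℝ) ^ 2) a (l * α)‖ ^ 4 ≤
      240 * Real.pi / R * (A ^ 4 * (X * Real.log X)) := by
  refine (integral_lorentz_mul_expSum_sq_four_le s a ha hR hl).trans ?_
  set N := ⌊√X⌋₊ with hN
  have hX0 : 0 < X := by linarith
  have hNX : (N : ℝ) ≤ √X := Nat.floor_le (Real.sqrt_nonneg X)
  have hN1 : 1 ≤ N := by
    rw [hN, Nat.one_le_floor_iff]
    exact Real.one_le_sqrt.mpr (by linarith)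
  have hN2 : (N : ℝ) ^ 2 ≤ X := by
    calc (N : ℝ) ^ 2 ≤ √X ^ 2 := by gcongr
      _ = X := Real.sq_sqrt hX0.le
  have hsub : s ⊆ Finset.Icc 1 N := by
    intro n hn
    obtain ⟨h1, h2⟩ := hs n hn
    exact Finset.mem_Icc.mpr ⟨h1, Nat.le_floor (Real.le_sqrt_of_sq_le h2)⟩
  have hE := card_sq_add_sq_eq_le s N hsub
  have hM := card_mulSolutions_le (2 * N)
  have hN0 : (0 : ℝ) < N := by exact_mod_cast hN1
  have hlog2 := Real.log_two_gt_d9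
  have hlogX : Real.log 2 ≤ Real.log X := Real.log_le_log (by norm_num) hX
  have hlogN : Real.log ((2 * N : ℕ) : ℝ) ≤ 3 / 2 * Real.log X := by
    push_cast
    rw [Real.log_mul (by norm_num) hN0.ne']
    have : 2 * Real.log N ≤ Real.log X := by
      have := Real.log_le_log (by positivity) hN2
      rw [Real.log_pow] at this
      exact_mod_cast this
    linarith
  have hbound : (N : ℝ) ^ 2 + 2 * ((mulSolutions (2 * N)).card : ℝ) ≤
      60 * (X * Real.log X) := by
    have hL : 0 < Real.log X := by linarith
    calc (N : ℝ) ^ 2 + 2 * ((mulSolutions (2 * N)).card : ℝ)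
        ≤ (N : ℝ) ^ 2 + 2 * (2 * ((2 * N : ℕ) : ℝ) ^ 2 * (1 + 3 / 2 * Real.log X)) := by
          gcongr
          refine hM.trans ?_
          gcongr
      _ = (N : ℝ) ^ 2 * (17 + 24 * Real.log X) := by push_cast; ring
      _ ≤ X * (17 + 24 * Real.log X) := by gcongr
      _ ≤ X * (60 * Real.log X) := by
          gcongr
          linarith
      _ = _ := by ring
  have hpi := Real.pi_pos
  calc _ ≤ 4 * Real.pi / R * (A ^ 4 * (60 * (X * Real.log X))) := by
        gcongr
        exact hE.trans hbound
    _ = _ := by ring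

lemma abs_natCast_sub_le_abs_rpow_sub {k : ℝ} (hk : 1 ≤ k) {n m : ℕ} (hn : 1 ≤ n) (hm : 1 ≤ m) :
    |(n : ℝ) - m| ≤ |(n : ℝ) ^ k - (m : ℝ) ^ k| := by
  wlog h : m ≤ n generalizing n m
  · rw [abs_sub_comm, abs_sub_comm ((n : ℝ) ^ k)]
    exact this hm hn (by omega)
  have hn' : (1 : ℝ) ≤ n := by exact_mod_cast hn
  have hm' : (1 : ℝ) ≤ m := by exact_mod_cast hm
  have h' : (m : ℝ) ≤ n := by exact_mod_cast h
  have hpow : ∀ x : ℝ, 1 ≤ x → x ^ k = x * x ^ (k - 1) := by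
    intro x hx
    rw [← Real.rpow_one_add' (by linarith) (by linarith)]
    congr 1
    ring
  have h1 : (m : ℝ) ^ (k - 1) ≤ (n : ℝ) ^ (k - 1) :=
    Real.rpow_le_rpow (by linarith) h' (by linarith)
  have h2 : 1 ≤ (n : ℝ) ^ (k - 1) := Real.one_le_rpow hn' (by linarith)
  rw [abs_of_nonneg (by linarith)]
  refine le_trans ?_ (le_abs_self _)
  rw [hpow _ hn', hpow _ hm']
  nlinarith

lemma Kf_le_lorentz (η : ℝ) {R α : ℝ} (hR : 0 < R) (hα : R < |α|) :
    Kf η α ≤ 2 * lorentz R α := by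
  have hα0 : α ≠ 0 := fun h => by simp [h] at hα; linarith
  have hsq : R ^ 2 ≤ α ^ 2 := by
    rw [← sq_abs α]
    gcongr
  have hα2 : 0 < α ^ 2 := by positivity
  unfold Kf lorentz
  rw [if_neg hα0, div_pow, mul_pow, ← div_eq_mul_inv, div_le_div_iff₀ (by positivity)
    (by positivity)]
  have h1 := Real.sin_sq_le_one (Real.pi * α * η)
  have h2 : 1 ≤ Real.pi ^ 2 := by nlinarith [Real.pi_gt_three]
  calc Real.sin (Real.pi * α * η) ^ 2 * (R ^ 2 + α ^ 2) ≤ 1 * (α ^ 2 + α ^ 2) := by gcongr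
    _ ≤ 2 * (Real.pi ^ 2 * α ^ 2) := by nlinarith

lemma Kf_nonneg (η α : ℝ) : 0 ≤ Kf η α := by
  unfold Kf
  split_ifs <;> positivity

/-- The primes occurring in `S k δ X`. -/
def primeRange (k δ X : ℝ) : Finset ℕ :=
  (Finset.range (⌈X⌉₊ + 1)).filter
    (fun p : ℕ => p.Prime ∧ δ * X ≤ (p : ℝ) ^ k ∧ (p : ℝ) ^ k ≤ X)

/-- The integers occurring in `Stilde δ X`. -/
def squareRange (δ X : ℝ) : Finset ℕ :=
  (Finset.range (⌈X⌉₊ + 1)).filter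
    (fun m : ℕ => δ * X ≤ (m : ℝ) ^ 2 ∧ (m : ℝ) ^ 2 ≤ X)

lemma S_eq_expSum (k δ X α : ℝ) :
    S k δ X α = expSum (primeRange k δ X) (fun n => (n : ℝ) ^ k)
      (fun n => (Real.log n : ℂ)) α := rfl

lemma S_two_eq_expSum (δ X α : ℝ) :
    S 2 δ X α = expSum (primeRange 2 δ X) (fun n => (n : ℝ) ^ 2)
      (fun n => (Real.log n : ℂ)) α := by
  rw [S_eq_expSum]
  simp_rw [Real.rpow_two]

lemma Stilde_eq_expSum (δ X α : ℝ) :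
    Stilde δ X α = expSum (squareRange δ X) (fun n => (n : ℝ) ^ 2)
      (fun n => (rho X n : ℂ)) α := rfl

lemma norm_log_le_of_mem_primeRange {k δ X : ℝ} (hk : 1 ≤ k) {p : ℕ}
    (hp : p ∈ primeRange k δ X) : ‖(Real.log p : ℂ)‖ ≤ Real.log X := by
  obtain ⟨-, h1, -, h3⟩ := Finset.mem_filter.mp hp
  have hp1 : (1 : ℝ) ≤ p := by exact_mod_cast h1.one_le
  rw [Complex.norm_real, Real.norm_of_nonneg (Real.log_nonneg hp1)]
  refine Real.log_le_log (by linarith) (le_trans ?_ h3)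
  simpa using Real.rpow_le_rpow_of_exponent_le hp1 hk

lemma integral_lorentz_mul_S_two_four_le (δ : ℝ) {X R l : ℝ} (hX : 2 ≤ X) (hR : 0 < R)
    (hl : 2 ≤ R * |l|) :
    ∫ α, lorentz R α * ‖S 2 δ X (l * α)‖ ^ 4 ≤
      240 * Real.pi / R * (Real.log X ^ 4 * (X * Real.log X)) := by
  simp_rw [S_two_eq_expSum]
  refine integral_lorentz_mul_expSum_sq_four_le_log hX _ _ (fun n hn => ?_)
    (fun n hn => norm_log_le_of_mem_primeRange (by norm_num) hn) hR hl
  obtain ⟨-, h1, -, h3⟩ := Finset.mem_filter.mp hn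
  exact ⟨h1.one_le, by simpa using h3⟩

lemma integral_lorentz_mul_Stilde_four_le {δ X R l : ℝ} (hδ : 0 < δ) (hX : 2 ≤ X) (hR : 0 < R)
    (hl : 2 ≤ R * |l|) :
    ∫ α, lorentz R α * ‖Stilde δ X (l * α)‖ ^ 4 ≤
      240 * Real.pi / R * (4 ^ 4 * (X * Real.log X)) := by
  simp_rw [Stilde_eq_expSum]
  have hmem : ∀ n ∈ squareRange δ X, 1 ≤ n ∧ (n : ℝ) ^ 2 ≤ X := by
    intro n hn
    obtain ⟨-, h2, h3⟩ := Finset.mem_filter.mp hn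
    refine ⟨?_, h3⟩
    rcases Nat.eq_zero_or_pos n with rfl | h
    · have : 0 < δ * X := by positivity
      simp at h2
      linarith
    · exact h
  refine integral_lorentz_mul_expSum_sq_four_le_log hX _ _ hmem (fun n hn => ?_) hR hl
  rw [Complex.norm_real]
  exact abs_rho_le (by linarith) (hmem n hn).1 (hmem n hn).2

lemma integral_lorentz_mul_S_sq_le {k : ℝ} (hk : 1 < k) (δ : ℝ) {X R l : ℝ} (hX : 2 ≤ X)
    (hR : 0 < R) (hl : 2 ≤ R * |l|) :
    ∫ α, lorentz R α * ‖S k δ X (l * α)‖ ^ 2 ≤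
      4 * Real.pi / R * (X ^ (1 / k) * Real.log X ^ 2) := by
  simp_rw [S_eq_expSum]
  have hX0 : 0 ≤ X := by linarith
  have hmem : ∀ n ∈ primeRange k δ X, 1 ≤ n := fun n hn => (Finset.mem_filter.mp hn).2.1.one_le
  refine (integral_lorentz_mul_expSum_sq_le _ _ _ (fun n hn m hm =>
    abs_natCast_sub_le_abs_rpow_sub hk.le (hmem n hn) (hmem m hm)) hR hl).trans ?_
  have hpi := Real.pi_pos
  gcongr
  have hsub : primeRange k δ X ⊆ Finset.Icc 1 ⌊X ^ (1 / k)⌋₊ := by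
    intro n hn
    refine Finset.mem_Icc.mpr ⟨hmem n hn, Nat.le_floor ?_⟩
    rw [one_div]
    exact (Real.le_rpow_inv_iff_of_pos (Nat.cast_nonneg n) hX0 (by linarith)).mpr
      (Finset.mem_filter.mp hn).2.2.2
  have hcard : ((primeRange k δ X).card : ℝ) ≤ X ^ (1 / k) := by
    refine le_trans ?_ (Nat.floor_le (by positivity))
    exact_mod_cast (Finset.card_le_card hsub).trans (by simp)
  calc ∑ n ∈ primeRange k δ X, ‖(Real.log n : ℂ)‖ ^ 2
      ≤ (primeRange k δ X).card • Real.log X ^ 2 := by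
        refine Finset.sum_le_card_nsmul _ _ _ fun n hn => ?_
        have := norm_log_le_of_mem_primeRange hk.le hn
        gcongr
    _ ≤ X ^ (1 / k) * Real.log X ^ 2 := by
        rw [nsmul_eq_mul]
        gcongr

lemma norm_S_two_le (δ X α : ℝ) : ‖S 2 δ X α‖ ≤ 2 * √X := by
  rw [S_two_eq_expSum]
  refine (norm_expSum_le _ _ _ _).trans ?_
  have h1 : ∑ n ∈ primeRange 2 δ X, ‖(Real.log n : ℂ)‖ ≤ Chebyshev.theta √X := by
    rw [Chebyshev.theta]
    calc ∑ n ∈ primeRange 2 δ X, ‖(Real.log n : ℂ)‖ = ∑ n ∈ primeRange 2 δ X, Real.log n := by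
          refine Finset.sum_congr rfl fun n _ => ?_
          rw [Complex.norm_real, Real.norm_of_nonneg (Real.log_natCast_nonneg n)]
      _ ≤ _ := by
          refine Finset.sum_le_sum_of_subset_of_nonneg (fun n hn => ?_)
            fun n _ _ => Real.log_natCast_nonneg n
          obtain ⟨-, h1, -, h3⟩ := Finset.mem_filter.mp hn
          rw [Real.rpow_two] at h3
          exact Finset.mem_filter.mpr
            ⟨Finset.mem_Ioc.mpr ⟨h1.pos, Nat.le_floor (Real.le_sqrt_of_sq_le h3)⟩, h1⟩
  have h2 := Chebyshev.theta_le_log4_mul_x (Real.sqrt_nonneg X)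
  have h3 : Real.log 4 ≤ 2 := by
    rw [show (4 : ℝ) = 2 ^ 2 by norm_num, Real.log_pow]
    have := Real.log_two_lt_d9
    push_cast
    linarith
  exact h1.trans (h2.trans (by gcongr))

lemma mul_mul_le_of_pos {a b d s t : ℝ} (hs : 0 < s) (ht : 0 < t) :
    a * b * d ≤ t * s / 4 * a ^ 4 + t / s / 4 * b ^ 4 + 1 / (2 * t) * d ^ 2 := by
  have h1 : a * b * d ≤ t / 2 * (a ^ 2 * b ^ 2) + 1 / (2 * t) * d ^ 2 := by
    have : 0 ≤ (t * (a * b) - d) ^ 2 / (2 * t) := by positivity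
    have h : (t * (a * b) - d) ^ 2 / (2 * t) =
        t / 2 * (a ^ 2 * b ^ 2) + 1 / (2 * t) * d ^ 2 - a * b * d := by
      field_simp
      ring
    linarith
  have h2 : t / 2 * (a ^ 2 * b ^ 2) ≤ t * s / 4 * a ^ 4 + t / s / 4 * b ^ 4 := by
    have : 0 ≤ t / 4 * ((s * a ^ 2 - b ^ 2) ^ 2 / s) := by positivity
    have h : t / 4 * ((s * a ^ 2 - b ^ 2) ^ 2 / s) =
        t * s / 4 * a ^ 4 + t / s / 4 * b ^ 4 - t / 2 * (a ^ 2 * b ^ 2) := by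
      field_simp
      ring
    linarith
  linarith

theorem statement17 (k δ l1 l2 l3 l4 ω : ℝ) (hk : 1 < k) (hδ0 : 0 < δ) (hδ1 : δ < 1)
    (h1 : l1 ≠ 0) (h2 : l2 ≠ 0) (h3 : l3 ≠ 0) (h4 : l4 ≠ 0) :
    ∃ C > 0, ∀ X ≥ (2 : ℝ), ∀ η : ℝ, 0 < η →
      ∀ R : ℝ, max (max (2 / |l1|) (2 / |l2|)) (max (2 / |l3|) (2 / |l4|)) ≤ R →
      ‖Ical k δ l1 l2 l3 l4 η ω X {α : ℝ | R < |α|}‖ ≤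
        C * X ^ (1 + 1 / (2 * k)) * (Real.log X) ^ ((5 : ℝ) / 2) / R := by
  have hpi := Real.pi_pos
  refine ⟨4 * (257 * 60 * Real.pi + 2 * Real.pi), by positivity, fun X hX η _ R hmax => ?_⟩
  simp only [max_le_iff, div_le_iff₀ (abs_pos.mpr h1), div_le_iff₀ (abs_pos.mpr h2),
    div_le_iff₀ (abs_pos.mpr h3), div_le_iff₀ (abs_pos.mpr h4)] at hmax
  obtain ⟨⟨hR1, hR2⟩, -, hR4⟩ := hmax
  have hR : 0 < R := by
    by_contra h
    have := mul_nonpos_of_nonpos_of_nonneg (not_lt.mp h) (abs_nonneg l1)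
    linarith
  have hX0 : 0 < X := by linarith
  have hL : 0 < Real.log X := Real.log_pos (by linarith)
  obtain ⟨v, hv, hv1, hv2⟩ : ∃ v : ℝ, 0 < v ∧ X ^ (1 / k) = v ^ 2 ∧
      X ^ (1 + 1 / (2 * k)) = X * v := by
    refine ⟨X ^ (1 / (2 * k)), by positivity, ?_, ?_⟩
    · rw [← Real.rpow_natCast, ← Real.rpow_mul hX0.le]
      congr 1
      push_cast
      field_simp
    · rw [Real.rpow_add hX0, Real.rpow_one]
  obtain ⟨q, hq, hq1, hq2⟩ : ∃ q : ℝ, 0 < q ∧ Real.log X = q ^ 2 ∧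
      Real.log X ^ ((5 : ℝ) / 2) = q ^ 5 := by
    refine ⟨Real.log X ^ ((1 : ℝ) / 2), by positivity, ?_, ?_⟩
    · rw [← Real.rpow_natCast, ← Real.rpow_mul hL.le]
      norm_num
    · rw [← Real.rpow_natCast, ← Real.rpow_mul hL.le]
      norm_num
  have hy : 0 < √X := Real.sqrt_pos.mpr hX0
  have hy2 : X = √X ^ 2 := (Real.sq_sqrt hX0.le).symm
  set t : ℝ := v / (√X * q) with ht
  set s : ℝ := q ^ 4 with hs
  have ht0 : 0 < t := by positivity
  have hs0 : 0 < s := by positivity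
  have hA := integral_lorentz_mul_Stilde_four_le hδ0 hX hR hR1
  have hB := integral_lorentz_mul_S_two_four_le δ hX hR hR2
  have hD := integral_lorentz_mul_S_sq_le hk δ hX hR hR4
  have iA : Integrable fun α => lorentz R α * ‖Stilde δ X (l1 * α)‖ ^ 4 :=
    integrable_lorentz_mul_expSum_pow _ _ _ hR l1 4
  have iB : Integrable fun α => lorentz R α * ‖S 2 δ X (l2 * α)‖ ^ 4 :=
    integrable_lorentz_mul_expSum_pow _ _ _ hR l2 4
  have iD : Integrable fun α => lorentz R α * ‖S k δ X (l4 * α)‖ ^ 2 :=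
    integrable_lorentz_mul_expSum_pow _ _ _ hR l4 2
  have iA' := iA.const_mul (4 * √X * (t * s / 4))
  have iB' := iB.const_mul (4 * √X * (t / s / 4))
  have iD' := iD.const_mul (4 * √X * (1 / (2 * t)))
  set g : ℝ → ℝ := fun α =>
    4 * √X * (t * s / 4) * (lorentz R α * ‖Stilde δ X (l1 * α)‖ ^ 4) +
    4 * √X * (t / s / 4) * (lorentz R α * ‖S 2 δ X (l2 * α)‖ ^ 4) +
    4 * √X * (1 / (2 * t)) * (lorentz R α * ‖S k δ X (l4 * α)‖ ^ 2) with hg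
  have ig : Integrable g := (iA'.add iB').add iD'
  have hg0 : ∀ α, 0 ≤ g α := by
    intro α
    have := lorentz_nonneg R α
    simp only [hg]
    positivity
  have hmeas : MeasurableSet {α : ℝ | R < |α|} := measurableSet_lt measurable_const (by fun_prop)
  have hle : ∀ α ∈ {α : ℝ | R < |α|}, ‖Stilde δ X (l1 * α) * S 2 δ X (l2 * α) *
      S 2 δ X (l3 * α) * S k δ X (l4 * α) * (Kf η α : ℂ) * e (-(ω * α))‖ ≤ g α := by
    intro α hα
    have hK := Kf_le_lorentz η hR hα
    have hw := lorentz_nonneg R α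
    rw [norm_mul, norm_mul, norm_mul, norm_mul, norm_mul, norm_e, mul_one, Complex.norm_real,
      Real.norm_of_nonneg (Kf_nonneg η α)]
    calc ‖Stilde δ X (l1 * α)‖ * ‖S 2 δ X (l2 * α)‖ * ‖S 2 δ X (l3 * α)‖ *
          ‖S k δ X (l4 * α)‖ * Kf η α
        ≤ ‖Stilde δ X (l1 * α)‖ * ‖S 2 δ X (l2 * α)‖ * (2 * √X) *
          ‖S k δ X (l4 * α)‖ * (2 * lorentz R α) := by
          gcongr
          · exact Kf_nonneg η α
          · exact norm_S_two_le δ X _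
      _ = 4 * √X * lorentz R α * (‖Stilde δ X (l1 * α)‖ * ‖S 2 δ X (l2 * α)‖ *
          ‖S k δ X (l4 * α)‖) := by ring
      _ ≤ 4 * √X * lorentz R α * (t * s / 4 * ‖Stilde δ X (l1 * α)‖ ^ 4 +
          t / s / 4 * ‖S 2 δ X (l2 * α)‖ ^ 4 + 1 / (2 * t) * ‖S k δ X (l4 * α)‖ ^ 2) := by
          gcongr
          exact mul_mul_le_of_pos hs0 ht0
      _ = g α := by simp only [hg]; ring
  calc ‖Ical k δ l1 l2 l3 l4 η ω X {α : ℝ | R < |α|}‖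
      ≤ ∫ α in {α : ℝ | R < |α|}, g α :=
        norm_integral_le_of_norm_le ig.integrableOn (ae_restrict_of_forall_mem hmeas hle)
    _ ≤ ∫ α, g α := setIntegral_le_integral ig (Filter.Eventually.of_forall hg0)
    _ = 4 * √X * (t * s / 4) * (∫ α, lorentz R α * ‖Stilde δ X (l1 * α)‖ ^ 4) +
        4 * √X * (t / s / 4) * (∫ α, lorentz R α * ‖S 2 δ X (l2 * α)‖ ^ 4) +
        4 * √X * (1 / (2 * t)) * (∫ α, lorentz R α * ‖S k δ X (l4 * α)‖ ^ 2) := by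
        have e1 := integral_add iA' iB'
        have e2 : ∫ α, g α = _ := integral_add (iA'.add iB') iD'
        rw [e2, e1, integral_const_mul, integral_const_mul, integral_const_mul]
    _ ≤ 4 * √X * (t * s / 4) * (240 * Real.pi / R * (4 ^ 4 * (X * Real.log X))) +
        4 * √X * (t / s / 4) * (240 * Real.pi / R * (Real.log X ^ 4 * (X * Real.log X))) +
        4 * √X * (1 / (2 * t)) * (4 * Real.pi / R * (X ^ (1 / k) * Real.log X ^ 2)) := by
        gcongr
    _ = 4 * (257 * 60 * Real.pi + 2 * Real.pi) * X ^ (1 + 1 / (2 * k)) *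
        (Real.log X) ^ ((5 : ℝ) / 2) / R := by
        rw [hv2, hq2, hv1, hq1, ht, hs]
        generalize √X = y at *
        subst hy2
        field_simp
        ring

end
end

section
/- Let k > 1, 0 < δ < 1, let λ₁, λ₂, λ₃, λ₄ be non-zero real numbers, let 0 < u ≤ 1/14 and ε > 0. There exist C > 0 and X₀ such that for all X ≥ X₀, all η with 0 < η ≤ 1, and every measurable set 𝔪' ⊆ ℝ on which |S̃_2(λ₁α)| ≤ X^{1/2 − u + ε} for all α ∈ 𝔪', one has ∫_{𝔪'} |S̃_2(λ₁α)| |S_2(λ₂α)| |S_2(λ₃α)| |S_k(λ₄α)| K_η(α) dα ≤ C η X^{1 − u + 1/(2k) + ε} (log X)^{5/2}. -/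
open scoped Classical
open MeasureTheory

noncomputable section

lemma card_linear_congruence_le_two {p x z : ℕ} (hp : p.Prime) (hx : 0 < x) (hxp : x < p) :
    ((Finset.Icc 1 x).filter (fun w : ℕ => ∃ y : ℕ, x * y + z * w = 2 * p)).card ≤ 2 := by
  have key : ∀ w w' : ℕ, (∃ y : ℕ, x * y + z * w = 2 * p) → (∃ y : ℕ, x * y + z * w' = 2 * p) →
      w ≤ w' → x ∣ 2 * (w' - w) := by
    rintro w w' ⟨y, hy⟩ ⟨y', hy'⟩ hw
    have hg : Nat.gcd x z ∣ 2 := by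
      have h1 : Nat.gcd x z ∣ 2 * p := by
        rw [← hy]
        exact dvd_add ((Nat.gcd_dvd_left x z).mul_right y) ((Nat.gcd_dvd_right x z).mul_right w)
      refine Nat.Coprime.dvd_of_dvd_mul_right ?_ h1
      refine Nat.Coprime.coprime_dvd_left (Nat.gcd_dvd_left x z) ?_
      exact ((Nat.Prime.coprime_iff_not_dvd hp).2 (Nat.not_dvd_of_pos_of_lt hx hxp)).symm
    have h2 : x ∣ z * (w' - w) := by
      obtain ⟨d, rfl⟩ := Nat.exists_eq_add_of_le hw
      rw [Nat.add_sub_cancel_left]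
      have : x * y = x * y' + z * d := by nlinarith
      exact (Nat.dvd_add_right (Dvd.intro y' rfl)).1 (this ▸ Dvd.intro y rfl)
    have h3 : x ∣ Nat.gcd (x * (w' - w)) (z * (w' - w)) :=
      Nat.dvd_gcd (Dvd.intro _ rfl) h2
    rw [Nat.gcd_mul_right] at h3
    exact h3.trans (Nat.mul_dvd_mul_right hg _)
  have inj : ∀ w w' : ℕ, w ∈ Finset.Icc 1 x → w' ∈ Finset.Icc 1 x →
      (∃ y : ℕ, x * y + z * w = 2 * p) → (∃ y : ℕ, x * y + z * w' = 2 * p) →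
      (2 * w ≤ x ↔ 2 * w' ≤ x) → w ≤ w' → w = w' := by
    intro w w' h1 h2 h3 h4 h5 h6
    rw [Finset.mem_Icc] at h1 h2
    by_contra hne
    have := Nat.le_of_dvd (by omega) (key w w' h3 h4 h6)
    omega
  have := Finset.card_le_card_of_injOn
    (s := (Finset.Icc 1 x).filter (fun w : ℕ => ∃ y : ℕ, x * y + z * w = 2 * p))
    (t := (Finset.univ : Finset Prop)) (fun w => 2 * w ≤ x) (fun _ _ => Finset.mem_univ _) (by
      intro w hw w' hw' h
      simp only [Finset.coe_filter, Set.mem_ofPred_eq] at hw hw'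
      rcases le_total w w' with h6 | h6
      · exact inj w w' hw.1 hw'.1 hw.2 hw'.2 (Eq.to_iff h) h6
      · exact (inj w' w hw'.1 hw.1 hw'.2 hw.2 (Eq.to_iff h.symm) h6).symm)
  simpa using this

lemma exists_four_factorization {h s j t : ℕ} (hh : 0 < h) (e : h * s = j * t) :
    ∃ x y z w : ℕ, h = x * y ∧ s = z * w ∧ j = x * z ∧ t = y * w := by
  obtain ⟨x, y, ⟨z, hz⟩, ⟨w, hw⟩, rfl⟩ := exists_dvd_and_dvd_of_dvd_mul (Dvd.intro s e)
  refine ⟨x, y, z, w, rfl, ?_, hz, hw⟩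
  subst hz hw
  apply Nat.eq_of_mul_eq_mul_left hh
  rw [e]; ring

/-- Every solution of `p² + b² = a² + c²` with `a < p` comes from a factorization in which one
factor is small. -/
lemma exists_ordered_factorization {N p a b c : ℕ} (hp : p ≤ N) (ha : 0 < a) (hb : 0 < b)
    (hc : c ≤ N) (hap : a < p) (e : p ^ 2 + b ^ 2 = a ^ 2 + c ^ 2) :
    ∃ x y z w : ℕ, 0 < x ∧ 0 < w ∧ 0 < z ∧ w ≤ x ∧ x * x ≤ 2 * N ∧ x * z ≤ 2 * N ∧
      x * y + z * w = 2 * p ∧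
      2 * (a : ℤ) = |(z * w : ℤ) - x * y| ∧ 2 * (b : ℤ) = |(y * w : ℤ) - x * z| ∧
      2 * (c : ℤ) = x * z + y * w := by
  have hbc : b < c := by nlinarith
  have e' : (p - a) * (p + a) = (c - b) * (c + b) := by
    obtain ⟨d, rfl⟩ := Nat.exists_eq_add_of_lt hap
    obtain ⟨f, rfl⟩ := Nat.exists_eq_add_of_lt hbc
    have h1 : a + d + 1 - a = d + 1 := by omega
    have h2 : b + f + 1 - b = f + 1 := by omega
    rw [h1, h2]; nlinarith
  obtain ⟨x, y, z, w, e1, e2, e3, e4⟩ := exists_four_factorization (by omega) e'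
  have hx : 0 < x := by
    rcases Nat.eq_zero_or_pos x with h | h
    · subst h; simp at e1; omega
    · exact h
  have hy : 0 < y := by
    rcases Nat.eq_zero_or_pos y with h | h
    · subst h; simp at e1; omega
    · exact h
  have hz : 0 < z := by
    rcases Nat.eq_zero_or_pos z with h | h
    · subst h; simp at e2; omega
    · exact h
  have hw : 0 < w := by
    rcases Nat.eq_zero_or_pos w with h | h
    · subst h; simp at e2; omega
    · exact h
  have b1 : x * y ≤ 2 * N := by omega
  have b2 : z * w ≤ 2 * N := by omega
  have b3 : x * z ≤ 2 * N := by omega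
  have b4 : y * w ≤ 2 * N := by omega
  have s1 : x * y + z * w = 2 * p := by omega
  have s2 : 2 * (a : ℤ) = (z * w : ℤ) - x * y := by
    have : 2 * a + x * y = z * w := by omega
    have := congrArg (Nat.cast (R := ℤ)) this; push_cast at this; linarith
  have s3 : 2 * (b : ℤ) = (y * w : ℤ) - x * z := by
    have : 2 * b + x * z = y * w := by omega
    have := congrArg (Nat.cast (R := ℤ)) this; push_cast at this; linarith
  have s4 : 2 * (c : ℤ) = x * z + y * w := by
    have : 2 * c = x * z + y * w := by omega
    exact_mod_cast this
  have a1 : 2 * (a : ℤ) = |(z * w : ℤ) - x * y| := by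
    rw [← s2, abs_of_nonneg]; positivity
  have a2 : 2 * (b : ℤ) = |(y * w : ℤ) - x * z| := by
    rw [← s3, abs_of_nonneg]; positivity
  have main : (x * x ≤ 2 * N ∧ w * w ≤ 2 * N) ∨ (y * y ≤ 2 * N ∧ z * z ≤ 2 * N) := by
    by_contra hcon
    have hcases : (2 * N < x * x ∨ 2 * N < w * w) ∧ (2 * N < y * y ∨ 2 * N < z * z) := by omega
    have aux : ∀ u v : ℕ, 2 * N < u * u → 2 * N < v * v → u * v ≤ 2 * N → False := by
      intro u v hu hv huv
      rcases le_total u v with h | h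
      · exact absurd (Nat.mul_le_mul_left u h) (by omega)
      · exact absurd (Nat.mul_le_mul_right v h) (by omega)
    rcases hcases with ⟨h | h, h' | h'⟩
    · exact aux x y h h' b1
    · exact aux x z h h' b3
    · exact aux y w h' h b4
    · exact aux z w h' h b2
  rcases main with ⟨m1, m2⟩ | ⟨m1, m2⟩
  · rcases le_total w x with hle | hle
    · exact ⟨x, y, z, w, hx, hw, hz, hle, m1, b3, s1, a1, a2, s4⟩
    · refine ⟨w, z, y, x, hw, hx, hy, hle, m2, by linarith, by linarith, ?_, ?_, by linarith⟩
      · rw [a1, abs_sub_comm]; ring_nf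
      · rw [a2, abs_sub_comm]; ring_nf
  · rcases le_total z y with hle | hle
    · refine ⟨y, x, w, z, hy, hz, hw, hle, m1, by linarith, by linarith, ?_, ?_, by linarith⟩
      · rw [a1]; ring_nf
      · rw [a2, abs_sub_comm]
    · refine ⟨z, w, x, y, hz, hy, hx, hle, m2, by linarith, by linarith, ?_, ?_, by linarith⟩
      · rw [a1, abs_sub_comm]
      · rw [a2]; ring_nf

lemma card_equal_sums_of_two_squares_le {N p : ℕ} (hp : p.Prime) (hpN : p ≤ N)
    (hNp : 2 * N < p * p) :
    ((((Finset.Icc 1 N ×ˢ Finset.Icc 1 N ×ˢ Finset.Icc 1 N).filter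
      (fun t : ℕ × ℕ × ℕ => t.1 < p ∧ p ^ 2 + t.2.1 ^ 2 = t.1 ^ 2 + t.2.2 ^ 2)).card : ℕ) : ℝ) ≤
      4 * N * (1 + Real.log N) := by
  set K := Nat.sqrt (2 * N) with hK
  have hKp : K < p := Nat.sqrt_lt.2 hNp
  set Q : Finset (ℕ × ℕ × ℕ) := (Finset.Icc 1 K).biUnion (fun x =>
    (Finset.Icc 1 (2 * N / x)).biUnion (fun z =>
      ((Finset.Icc 1 x).filter (fun w : ℕ => ∃ y : ℕ, x * y + z * w = 2 * p)).image
        (fun w => (x, z, w)))) with hQ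
  let g : ℕ × ℕ × ℕ → ℕ × ℕ × ℕ := fun t =>
    let y : ℕ := (2 * p - t.2.1 * t.2.2) / t.1
    ((|(t.2.1 * t.2.2 : ℤ) - t.1 * y| / 2).toNat,
      (|(y * t.2.2 : ℤ) - t.1 * t.2.1| / 2).toNat, (((t.1 * t.2.1 : ℤ) + y * t.2.2) / 2).toNat)
  have hsub : ((Finset.Icc 1 N ×ˢ Finset.Icc 1 N ×ˢ Finset.Icc 1 N).filter
      (fun t : ℕ × ℕ × ℕ => t.1 < p ∧ p ^ 2 + t.2.1 ^ 2 = t.1 ^ 2 + t.2.2 ^ 2)) ⊆ Q.image g := by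
    rintro ⟨a, b, c⟩ ht
    simp only [Finset.mem_filter, Finset.mem_product, Finset.mem_Icc] at ht
    obtain ⟨⟨⟨ha, -⟩, ⟨hb, -⟩, -, hc⟩, hap, he⟩ := ht
    obtain ⟨x, y, z, w, hx, hw, hz, hwx, hxx, hxz, hs, e1, e2, e3⟩ :=
      exists_ordered_factorization hpN (by omega) (by omega) hc hap he
    have hy : (2 * p - z * w) / x = y := by
      rw [← hs, Nat.add_sub_cancel, Nat.mul_div_cancel_left _ hx]
    refine Finset.mem_image.2 ⟨(x, z, w), ?_, ?_⟩
    · rw [hQ]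
      refine Finset.mem_biUnion.2 ⟨x, Finset.mem_Icc.2 ⟨hx, Nat.le_sqrt.2 hxx⟩,
        Finset.mem_biUnion.2 ⟨z, Finset.mem_Icc.2 ⟨hz, ?_⟩, Finset.mem_image.2 ⟨w, ?_, rfl⟩⟩⟩
      · rw [Nat.le_div_iff_mul_le hx]; linarith
      · exact Finset.mem_filter.2 ⟨Finset.mem_Icc.2 ⟨hw, hwx⟩, y, hs⟩
    · simp only [g, hy, ← e1, ← e2, ← e3]
      ext <;> simp
  have hcard : Q.card ≤ ∑ x ∈ Finset.Icc 1 K, 2 * (2 * N / x) := by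
    refine Finset.card_biUnion_le.trans (Finset.sum_le_sum fun x hx => ?_)
    rw [Finset.mem_Icc] at hx
    refine Finset.card_biUnion_le.trans ?_
    refine (Finset.sum_le_card_nsmul _ _ 2 fun z _ => Finset.card_image_le.trans
      (card_linear_congruence_le_two hp hx.1 (by omega))).trans ?_
    simp [mul_comm]
  have h1 : ((∑ x ∈ Finset.Icc 1 K, 2 * (2 * N / x) : ℕ) : ℝ) ≤ 4 * N * (harmonic K : ℝ) := by
    rw [harmonic_eq_sum_Icc]
    push_cast
    rw [Finset.mul_sum]
    refine Finset.sum_le_sum fun x _ => ?_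
    have : ((2 * N / x : ℕ) : ℝ) ≤ ((2 * N : ℕ) : ℝ) / x := Nat.cast_div_le
    push_cast at this
    rw [div_eq_mul_inv] at this
    linarith
  have hK1 : 1 ≤ K := by
    rw [hK, Nat.le_sqrt]
    have := hp.two_le
    omega
  have hKN : K ≤ N := by omega
  calc _ ≤ ((∑ x ∈ Finset.Icc 1 K, 2 * (2 * N / x) : ℕ) : ℝ) := by
        exact_mod_cast (Finset.card_le_card hsub).trans (Finset.card_image_le.trans hcard)
    _ ≤ 4 * N * (harmonic K : ℝ) := h1
    _ ≤ 4 * N * (1 + Real.log N) := by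
        have := harmonic_le_one_add_log K
        have h3 : Real.log K ≤ Real.log N :=
          Real.log_le_log (by exact_mod_cast hK1) (by exact_mod_cast hKN)
        gcongr
        linarith

lemma sum_log_primes_le {P : Finset ℕ} {y : ℝ} (hy : 0 ≤ y) (hP : ∀ p ∈ P, p.Prime)
    (hPy : ∀ p ∈ P, (p : ℝ) ≤ y) : ∑ p ∈ P, Real.log p ≤ Real.log 4 * y := by
  refine le_trans ?_ (Chebyshev.theta_le_log4_mul_x hy)
  unfold Chebyshev.theta
  refine Finset.sum_le_sum_of_subset_of_nonneg (fun p hp => ?_)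
    (fun p _ _ => Real.log_natCast_nonneg p)
  have := hP p hp
  exact Finset.mem_filter.2 ⟨Finset.mem_Ioc.2 ⟨this.pos, Nat.le_floor (hPy p hp)⟩, this⟩

/-- The weighted number of solutions of `p₁² + p₂² = p₃² + p₄²` in primes. -/
lemma sum_log_equal_sums_of_two_squares_le {N : ℕ} {L : ℝ} (hL : 1 ≤ L)
    (hNL : Real.log N ≤ L) {P : Finset ℕ} (hP : ∀ p ∈ P, p.Prime ∧ p ≤ N ∧ 2 * N < p * p) :
    ∑ i ∈ P ×ˢ P, ∑ j ∈ P ×ˢ P,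
      (if i.1 ^ 2 + i.2 ^ 2 = j.1 ^ 2 + j.2 ^ 2 then
        (Real.log i.1 * Real.log i.2) * (Real.log j.1 * Real.log j.2) else 0) ≤
      25 * (N : ℝ) ^ 2 * L ^ 4 := by
  have hlog0 : ∀ p : ℕ, 0 ≤ Real.log p := Real.log_natCast_nonneg
  have hlogL : ∀ p ∈ P, Real.log p ≤ L := fun p hp =>
    (Real.log_le_log (by exact_mod_cast (hP p hp).1.pos)
      (by exact_mod_cast (hP p hp).2.1)).trans hNL
  have hL0 : 0 ≤ L := by linarith
  have hPN : P ⊆ Finset.Icc 1 N := fun p hp =>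
    Finset.mem_Icc.2 ⟨(hP p hp).1.pos, (hP p hp).2.1⟩
  have hPcard : (P.card : ℝ) ≤ N := by
    have := Finset.card_le_card hPN
    rw [Nat.card_Icc, Nat.add_sub_cancel] at this
    exact_mod_cast this
  set F : ℕ × ℕ → ℕ × ℕ → ℝ := fun i j =>
    if i.1 ^ 2 + i.2 ^ 2 = j.1 ^ 2 + j.2 ^ 2 then
        (Real.log i.1 * Real.log i.2) * (Real.log j.1 * Real.log j.2) else 0 with hF
  set G : ℕ × ℕ → ℕ × ℕ → ℝ := fun i j => if j.1 < i.1 then F i j else 0 with hG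
  have hFsymm : ∀ i j, F i j = F j i := by
    intro i j
    simp only [hF, eq_comm (a := i.1 ^ 2 + i.2 ^ 2)]
    split_ifs
    · ring
    · rfl
  have hsplit : ∀ i ∈ P ×ˢ P, ∀ j,
      F i j ≤ (if i = j then L ^ 4 else 0) + (G i j + G j i) := by
    intro i hi j
    rw [Finset.mem_product] at hi
    simp only [hG]
    rcases lt_trichotomy i.1 j.1 with h | h | h
    · have hne : i ≠ j := fun h' => by simp [h'] at h
      simp [hne, h, h.not_gt, hFsymm i j]
    · by_cases he : i = j
      · subst he
        simp only [hF, if_true, lt_irrefl, if_false, add_zero]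
        have a1 := hlogL _ hi.1; have a2 := hlogL _ hi.2
        have b1 := hlog0 i.1; have b2 := hlog0 i.2
        calc _ ≤ (L * L) * (L * L) := by gcongr
          _ = L ^ 4 := by ring
      · have : ¬ (i.1 ^ 2 + i.2 ^ 2 = j.1 ^ 2 + j.2 ^ 2) := by
          intro h'
          rw [h] at h'
          have : i.2 ^ 2 = j.2 ^ 2 := by omega
          exact he (Prod.ext h (Nat.pow_left_injective two_ne_zero this))
        have hFij : F i j = 0 := if_neg this
        rw [hFij]
        simp [he, h]
    · have hne : i ≠ j := fun h' => by simp [h'] at h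
      simp [hne, h, h.not_gt]
  have hGsum : ∑ i ∈ P ×ˢ P, ∑ j ∈ P ×ˢ P, G i j ≤ 8 * Real.log 4 * (N : ℝ) ^ 2 * L ^ 4 := by
    have hinner : ∀ p ∈ P, ∑ b ∈ P, ∑ j ∈ P ×ˢ P, G (p, b) j ≤
        Real.log p * L ^ 3 * (4 * N * (1 + Real.log N)) := by
      intro p hp
      obtain ⟨hpp, hpN, hpp2⟩ := hP p hp
      have hc := card_equal_sums_of_two_squares_le hpp hpN hpp2
      set T := ((Finset.Icc 1 N ×ˢ Finset.Icc 1 N ×ˢ Finset.Icc 1 N).filter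
        (fun t : ℕ × ℕ × ℕ => t.1 < p ∧ p ^ 2 + t.2.1 ^ 2 = t.1 ^ 2 + t.2.2 ^ 2)) with hT
      have hw : 0 ≤ Real.log p * L ^ 3 := mul_nonneg (hlog0 p) (by positivity)
      calc ∑ b ∈ P, ∑ j ∈ P ×ˢ P, G (p, b) j
          ≤ ∑ b ∈ P, ∑ j ∈ P ×ˢ P,
              (if j.1 < p ∧ p ^ 2 + b ^ 2 = j.1 ^ 2 + j.2 ^ 2 then Real.log p * L ^ 3 else 0) := by
            refine Finset.sum_le_sum fun b hb => Finset.sum_le_sum fun j hj => ?_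
            rw [Finset.mem_product] at hj
            simp only [hG, hF]
            by_cases h1 : j.1 < p
            · by_cases h2 : p ^ 2 + b ^ 2 = j.1 ^ 2 + j.2 ^ 2
              · simp only [h1, h2, and_self, if_true]
                have a1 := hlogL _ hj.1; have a2 := hlogL _ hj.2; have a3 := hlogL _ hb
                have b1 := hlog0 j.1; have b2 := hlog0 j.2; have b3 := hlog0 b
                have b4 := hlog0 p
                calc _ ≤ (Real.log p * L) * (L * L) := by gcongr
                  _ = _ := by ring
              · simp [h2]
            · simp [h1]
        _ = ∑ t ∈ (P ×ˢ P ×ˢ P).filter (fun t : ℕ × ℕ × ℕ =>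
              t.2.1 < p ∧ p ^ 2 + t.1 ^ 2 = t.2.1 ^ 2 + t.2.2 ^ 2), Real.log p * L ^ 3 := by
            rw [Finset.sum_filter, Finset.sum_product]
        _ = (((P ×ˢ P ×ˢ P).filter (fun t : ℕ × ℕ × ℕ =>
              t.2.1 < p ∧ p ^ 2 + t.1 ^ 2 = t.2.1 ^ 2 + t.2.2 ^ 2)).card : ℝ) *
              (Real.log p * L ^ 3) := by
            rw [Finset.sum_const, nsmul_eq_mul]
        _ ≤ (T.card : ℝ) * (Real.log p * L ^ 3) := by
            refine mul_le_mul_of_nonneg_right ?_ hw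
            rw [Nat.cast_le]
            refine Finset.card_le_card_of_injOn (fun t => (t.2.1, t.1, t.2.2)) ?_ ?_
            · rintro ⟨b, a, c⟩ ht
              simp only [Finset.coe_filter, Finset.mem_product, Set.mem_ofPred_eq] at ht
              simp only [hT, Finset.coe_filter, Finset.mem_product, Set.mem_ofPred_eq]
              exact ⟨⟨hPN ht.1.2.1, hPN ht.1.1, hPN ht.1.2.2⟩, ht.2⟩
            · rintro ⟨b, a, c⟩ - ⟨b', a', c'⟩ - h
              simp only [Prod.mk.injEq] at h ⊢
              tauto
        _ ≤ (4 * N * (1 + Real.log N)) * (Real.log p * L ^ 3) :=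
            mul_le_mul_of_nonneg_right hc hw
        _ = _ := by ring
    rw [Finset.sum_product]
    calc _ ≤ ∑ p ∈ P, Real.log p * L ^ 3 * (4 * N * (1 + Real.log N)) :=
          Finset.sum_le_sum hinner
      _ = (∑ p ∈ P, Real.log p) * (L ^ 3 * (4 * N * (1 + Real.log N))) := by
          rw [Finset.sum_mul]
          exact Finset.sum_congr rfl fun p _ => by ring
      _ ≤ (Real.log 4 * N) * (L ^ 3 * (4 * N * (L + L))) := by
          have h1 := sum_log_primes_le (P := P) (y := N) (by positivity) (fun p hp => (hP p hp).1)
            (fun p hp => by exact_mod_cast (hP p hp).2.1)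
          have h2 : 0 ≤ Real.log N := hlog0 N
          have h3 : 0 ≤ Real.log 4 := Real.log_nonneg (by norm_num)
          gcongr
      _ = _ := by ring
  have hlog4 : Real.log 4 ≤ 1.4 := by
    have : (4 : ℝ) = 2 ^ 2 := by norm_num
    rw [this, Real.log_pow]
    have := Real.log_two_lt_d9
    push_cast
    linarith
  calc ∑ i ∈ P ×ˢ P, ∑ j ∈ P ×ˢ P, F i j
      ≤ ∑ i ∈ P ×ˢ P, ∑ j ∈ P ×ˢ P, ((if i = j then L ^ 4 else 0) + (G i j + G j i)) :=
        Finset.sum_le_sum fun i hi => Finset.sum_le_sum fun j _ =>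
          hsplit i hi j
    _ = (P.card : ℝ) ^ 2 * L ^ 4 + 2 * ∑ i ∈ P ×ˢ P, ∑ j ∈ P ×ˢ P, G i j := by
        simp only [Finset.sum_add_distrib]
        rw [Finset.sum_comm (f := fun i j => G j i)]
        have : ∑ i ∈ P ×ˢ P, ∑ j ∈ P ×ˢ P, (if i = j then L ^ 4 else 0) =
            (P.card : ℝ) ^ 2 * L ^ 4 := by
          rw [Finset.sum_congr rfl fun i hi => by rw [Finset.sum_ite_eq, if_pos hi],
            Finset.sum_const, Finset.card_product, nsmul_eq_mul]
          push_cast; ring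
        rw [this]; ring
    _ ≤ (N : ℝ) ^ 2 * L ^ 4 + 2 * (8 * Real.log 4 * (N : ℝ) ^ 2 * L ^ 4) := by gcongr
    _ = (1 + 16 * Real.log 4) * ((N : ℝ) ^ 2 * L ^ 4) := by ring
    _ ≤ 25 * ((N : ℝ) ^ 2 * L ^ 4) := by gcongr; linarith
    _ = _ := by ring

lemma measurable_Kf (η : ℝ) : Measurable (Kf η) := by
  unfold Kf
  exact Measurable.ite (measurableSet_singleton 0) measurable_const (by fun_prop)

lemma Kf_le_inv_one_add_sq (η α : ℝ) : Kf η α ≤ (η ^ 2 + 1) * (1 + α ^ 2)⁻¹ := by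
  rw [← div_eq_mul_inv, le_div_iff₀ (by positivity)]
  unfold Kf
  split_ifs with h
  · subst h; nlinarith
  · have hpi : Real.pi * α ≠ 0 := mul_ne_zero Real.pi_ne_zero h
    have h1 : (Real.sin (Real.pi * α * η) / (Real.pi * α)) ^ 2 ≤ η ^ 2 := by
      rw [div_pow, div_le_iff₀ (by positivity)]
      calc _ ≤ (Real.pi * α * η) ^ 2 := Real.sin_sq_le_sq
        _ = _ := by ring
    have h2 : (Real.sin (Real.pi * α * η) / (Real.pi * α)) ^ 2 * α ^ 2 ≤ 1 := by
      have : (Real.sin (Real.pi * α * η) / (Real.pi * α)) ^ 2 * α ^ 2 =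
          Real.sin (Real.pi * α * η) ^ 2 / Real.pi ^ 2 := by field_simp
      rw [this, div_le_one (by positivity)]
      nlinarith [Real.sin_sq_le_one (Real.pi * α * η), Real.pi_gt_three]
    linarith

lemma integrable_Kf (η : ℝ) : Integrable (Kf η) := by
  refine (integrable_inv_one_add_sq.const_mul (η ^ 2 + 1)).mono'
    (measurable_Kf η).aestronglyMeasurable (Filter.Eventually.of_forall fun α => ?_)
  rw [Real.norm_of_nonneg (Kf_nonneg η α)]
  exact Kf_le_inv_one_add_sq η α

/-- The triangle function supported on `[-η, η]`. -/
def triangle (η t : ℝ) : ℝ := max 0 (η - |t|)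

lemma continuous_triangle (η : ℝ) : Continuous (triangle η) := by
  unfold triangle; fun_prop

lemma support_triangle_subset (η : ℝ) : Function.support (triangle η) ⊆ Set.Ioc (-η) η := by
  intro t ht
  have : 0 < η - |t| := by
    by_contra h
    exact ht (max_eq_left (not_lt.1 h))
  have := abs_lt.1 (sub_pos.1 this)
  exact ⟨this.1, this.2.le⟩

lemma integrable_triangle (η : ℝ) : Integrable (triangle η) := by
  refine (continuous_triangle η).integrable_of_hasCompactSupport ?_
  exact HasCompactSupport.intro' (isCompact_Icc (a := -η) (b := η)) isClosed_Icc fun t ht => by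
    by_contra h
    exact ht (Set.Ioc_subset_Icc_self (support_triangle_subset η h))

lemma triangle_le {η : ℝ} (hη : 0 ≤ η) (t : ℝ) : triangle η t ≤ η :=
  max_le hη (by linarith [abs_nonneg t])

lemma triangle_eq_zero {η t : ℝ} (h : η ≤ |t|) : triangle η t = 0 := max_eq_left (by linarith)

lemma integral_exp_mul_linear {c : ℂ} (hc : c ≠ 0) (η : ℝ) :
    ∫ v in (0 : ℝ)..η, Complex.exp (c * v) * ((η : ℂ) - v) =
      Complex.exp (c * η) / c ^ 2 - η / c - 1 / c ^ 2 := by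
  have hd : ∀ v : ℝ, HasDerivAt
      (fun v : ℝ => ((η : ℂ) - v) * Complex.exp (c * v) / c + Complex.exp (c * v) / c ^ 2)
      (Complex.exp (c * v) * ((η : ℂ) - v)) v := by
    intro v
    have h1 : HasDerivAt (fun v : ℝ => (v : ℂ)) 1 v := Complex.ofRealCLM.hasDerivAt
    have h2 : HasDerivAt (fun v : ℝ => Complex.exp (c * v)) (Complex.exp (c * v) * (c * 1)) v :=
      (h1.const_mul c).cexp
    have h3 := (((h1.const_sub (η : ℂ)).mul h2).div_const c).add (h2.div_const (c ^ 2))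
    refine h3.congr_deriv ?_
    field_simp
    ring
  rw [intervalIntegral.integral_eq_sub_of_hasDerivAt (fun v _ => hd v)
    (Continuous.intervalIntegrable (by fun_prop) _ _)]
  simp
  ring

open scoped FourierTransform

lemma fourier_triangle {η : ℝ} (hη : 0 < η) :
    𝓕 (fun t : ℝ => (triangle η t : ℂ)) = fun α => (Kf η α : ℂ) := by
  ext w
  rw [Real.fourier_real_eq_integral_exp_smul]
  set c : ℂ := (-2 * Real.pi * w * Complex.I : ℂ) with hc
  have e1 : (fun v : ℝ => Complex.exp (((-2 * Real.pi * v * w : ℝ) : ℂ) * Complex.I) •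
      (triangle η v : ℂ)) = fun v : ℝ => Complex.exp (c * v) * (triangle η v : ℂ) := by
    ext v
    rw [smul_eq_mul, hc]
    push_cast
    ring_nf
  rw [e1, ← intervalIntegral.integral_eq_integral_of_support_subset (a := -η) (b := η)]
  swap
  · intro t ht
    apply support_triangle_subset η
    intro h
    simp [h] at ht
  have hcont : Continuous fun v : ℝ => Complex.exp (c * v) * (triangle η v : ℂ) := by
    have := continuous_triangle η
    fun_prop
  rw [← intervalIntegral.integral_add_adjacent_intervals (b := 0)
    (hcont.intervalIntegrable _ _) (hcont.intervalIntegrable _ _)]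
  have hpos : ∫ v in (0 : ℝ)..η, Complex.exp (c * v) * (triangle η v : ℂ) =
      ∫ v in (0 : ℝ)..η, Complex.exp (c * v) * ((η : ℂ) - v) := by
    refine intervalIntegral.integral_congr fun v hv => ?_
    rw [Set.uIcc_of_le hη.le] at hv
    simp only [triangle]
    rw [abs_of_nonneg hv.1, max_eq_right (by linarith [hv.2])]
    push_cast; rfl
  have hneg : ∫ v in (-η)..(0 : ℝ), Complex.exp (c * v) * (triangle η v : ℂ) =
      ∫ v in (0 : ℝ)..η, Complex.exp ((-c) * v) * ((η : ℂ) - v) := by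
    have := intervalIntegral.integral_comp_neg (a := 0) (b := η)
      (fun v : ℝ => Complex.exp (c * v) * (triangle η v : ℂ))
    rw [neg_zero] at this
    rw [← this]
    refine intervalIntegral.integral_congr fun v hv => ?_
    rw [Set.uIcc_of_le hη.le] at hv
    simp only [triangle]
    rw [abs_neg, abs_of_nonneg hv.1, max_eq_right (by linarith [hv.2])]
    push_cast
    ring_nf
  rw [hpos, hneg]
  by_cases hw : w = 0
  · have hc0 : c = 0 := by simp [hc, hw]
    simp only [hc0, hw, Kf, if_true, neg_zero, zero_mul, Complex.exp_zero, one_mul]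
    have : ∫ v in (0 : ℝ)..η, ((η : ℂ) - v) = ((∫ v in (0 : ℝ)..η, (η - v) : ℝ) : ℂ) := by
      rw [← intervalIntegral.integral_ofReal]
      push_cast; rfl
    rw [this, intervalIntegral.integral_sub (by simp) (by simp), integral_id]
    simp
    ring
  · have hc0 : c ≠ 0 := by simp [hc, hw, Real.pi_ne_zero]
    rw [integral_exp_mul_linear hc0, integral_exp_mul_linear (neg_ne_zero.2 hc0)]
    simp only [Kf, if_neg hw]
    have e2 : Complex.exp (c * η) + Complex.exp (-c * η) =
        2 - 4 * (Real.sin (Real.pi * w * η) : ℂ) ^ 2 := by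
      have h1 : c * η = -((2 * (Real.pi * w * η) : ℂ) * Complex.I) := by rw [hc]; ring
      have h2 : -c * η = (2 * (Real.pi * w * η) : ℂ) * Complex.I := by rw [hc]; ring
      have h3 := Complex.two_cos (2 * (Real.pi * w * η) : ℂ)
      rw [h1, h2]
      rw [Complex.cos_two_mul, Complex.cos_sq'] at h3
      push_cast
      rw [← neg_mul, add_comm, ← h3]
      ring
    have hcc : c ^ 2 = -(4 * (Real.pi * w : ℂ) ^ 2) := by
      rw [hc]
      ring_nf
      rw [Complex.I_sq]; ring
    have hpw : (Real.pi * w : ℂ) ≠ 0 := by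
      simp [hw, Real.pi_ne_zero]
    have e3 : Complex.exp (-c * η) / (-c) ^ 2 - η / (-c) - 1 / (-c) ^ 2 +
        (Complex.exp (c * η) / c ^ 2 - η / c - 1 / c ^ 2) =
        ((Complex.exp (c * η) + Complex.exp (-c * η)) - 2) / c ^ 2 := by
      field_simp
      ring
    rw [e3, e2, hcc]
    push_cast
    field_simp
    ring

lemma integral_Kf_mul_e {η : ℝ} (hη : 0 < η) (β : ℝ) :
    ∫ α, (Kf η α : ℂ) * e (β * α) = triangle η β := by
  have hF := fourier_triangle hη
  have h := Continuous.fourierInv_fourier_eq (f := fun t : ℝ => (triangle η t : ℂ))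
    (Complex.continuous_ofReal.comp (continuous_triangle η)) (integrable_triangle η).ofReal
    (by rw [hF]; exact (integrable_Kf η).ofReal)
  rw [hF] at h
  have := congrFun h β
  rw [← this, Real.fourierInv_eq']
  refine integral_congr_ae (Filter.Eventually.of_forall fun α => ?_)
  simp only [e, smul_eq_mul]
  rw [mul_comm]
  congr 2
  simp
  ring

section Moments

variable {ι : Type*}

lemma continuous_sum_mul_e (s : Finset ι) (a β : ι → ℝ) :
    Continuous fun α : ℝ => ∑ i ∈ s, (a i : ℂ) * e (β i * α) :=
  continuous_finsetSum s fun _ _ =>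
    continuous_const.mul (continuous_e.comp (continuous_const.mul continuous_id))

lemma norm_sum_mul_e_le (s : Finset ι) (a β : ι → ℝ) (α : ℝ) :
    ‖∑ i ∈ s, (a i : ℂ) * e (β i * α)‖ ≤ ∑ i ∈ s, |a i| := by
  refine (norm_sum_le _ _).trans (Finset.sum_le_sum fun i _ => ?_)
  rw [norm_mul, norm_e, mul_one, Complex.norm_real, Real.norm_eq_abs]

lemma integrable_norm_sum_pow_mul_Kf (s : Finset ι) (a β : ι → ℝ) (η : ℝ) (n : ℕ) :
    Integrable fun α : ℝ => ‖∑ i ∈ s, (a i : ℂ) * e (β i * α)‖ ^ n * Kf η α := by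
  refine (integrable_Kf η).bdd_mul (c := (∑ i ∈ s, |a i|) ^ n)
    ((continuous_sum_mul_e s a β).norm.pow n).aestronglyMeasurable
    (Filter.Eventually.of_forall fun α => ?_)
  rw [norm_pow, norm_norm]
  exact pow_le_pow_left₀ (norm_nonneg _) (norm_sum_mul_e_le s a β α) n

lemma e_mul_conj (x y : ℝ) : e x * (starRingEnd ℂ) (e y) = e (x - y) := by
  unfold e
  rw [← Complex.exp_conj, ← Complex.exp_add]
  congr 1
  simp only [map_mul, Complex.conj_I, Complex.conj_ofReal, map_ofNat]
  push_cast
  ring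

lemma integral_norm_sum_sq_mul_Kf (s : Finset ι) (a β : ι → ℝ) {η : ℝ} (hη : 0 < η) :
    ∫ α, ‖∑ i ∈ s, (a i : ℂ) * e (β i * α)‖ ^ 2 * Kf η α =
      ∑ i ∈ s, ∑ j ∈ s, a i * a j * triangle η (β i - β j) := by
  have hpt : ∀ α : ℝ, ((‖∑ i ∈ s, (a i : ℂ) * e (β i * α)‖ ^ 2 * Kf η α : ℝ) : ℂ) =
      ∑ i ∈ s, ∑ j ∈ s, ((a i * a j : ℝ) : ℂ) * ((Kf η α : ℂ) * e ((β i - β j) * α)) := by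
    intro α
    push_cast
    rw [← Complex.mul_conj', map_sum, Finset.sum_mul_sum, Finset.sum_mul]
    refine Finset.sum_congr rfl fun i _ => ?_
    rw [Finset.sum_mul]
    refine Finset.sum_congr rfl fun j _ => ?_
    rw [sub_mul, ← e_mul_conj, map_mul, Complex.conj_ofReal]
    ring
  have hint : ∀ c d : ℝ, Integrable fun α : ℝ => (c : ℂ) * ((Kf η α : ℂ) * e (d * α)) := by
    intro c d
    refine Integrable.const_mul ?_ _
    refine (integrable_Kf η).ofReal.mul_bdd (c := 1)
      (continuous_e.comp (continuous_const.mul continuous_id)).aestronglyMeasurable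
      (Filter.Eventually.of_forall fun α => ?_)
    exact (norm_e _).le
  have : ((∫ α, ‖∑ i ∈ s, (a i : ℂ) * e (β i * α)‖ ^ 2 * Kf η α : ℝ) : ℂ) =
      ((∑ i ∈ s, ∑ j ∈ s, a i * a j * triangle η (β i - β j) : ℝ) : ℂ) := by
    rw [← integral_complex_ofReal]
    simp_rw [hpt]
    rw [integral_finsetSum _ fun _ _ => integrable_finsetSum _ fun j _ => hint _ _]
    push_cast
    refine Finset.sum_congr rfl fun i _ => ?_
    rw [integral_finsetSum _ fun j _ => by simpa using hint (a i * a j) (β i - β j)]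
    refine Finset.sum_congr rfl fun j _ => ?_
    rw [integral_const_mul]
    rw [integral_Kf_mul_e hη]
  exact_mod_cast this

lemma abs_sin_natCast_mul_le (n : ℕ) (x : ℝ) : |Real.sin (n * x)| ≤ n * |Real.sin x| := by
  induction n with
  | zero => simp
  | succ n ih =>
    push_cast
    rw [add_mul, one_mul, Real.sin_add]
    have h1 := Real.abs_cos_le_one x
    have h2 := Real.abs_cos_le_one (n * x)
    calc _ ≤ |Real.sin (n * x)| * |Real.cos x| + |Real.cos (n * x)| * |Real.sin x| := by
          rw [← abs_mul, ← abs_mul]; exact abs_add_le _ _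
      _ ≤ |Real.sin (n * x)| * 1 + 1 * |Real.sin x| := by gcongr
      _ ≤ _ := by linarith

lemma Kf_le_sq_mul_Kf_div {M : ℕ} (hM : 0 < M) (η α : ℝ) :
    Kf η α ≤ (M : ℝ) ^ 2 * Kf (η / M) α := by
  have hM' : (M : ℝ) ≠ 0 := by positivity
  unfold Kf
  split_ifs with h
  · rw [div_pow, mul_div_cancel₀ _ (pow_ne_zero 2 hM')]
  · have := abs_sin_natCast_mul_le M (Real.pi * α * (η / M))
    have e1 : (M : ℝ) * (Real.pi * α * (η / M)) = Real.pi * α * η := by field_simp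
    rw [e1] at this
    have h2 := pow_le_pow_left₀ (abs_nonneg _) this 2
    rw [sq_abs, mul_pow, sq_abs] at h2
    rw [div_pow, div_pow, ← mul_div_assoc]
    gcongr

lemma integral_norm_sum_sq_mul_Kf_le (s : Finset ι) (a β : ι → ℝ) (ha : ∀ i ∈ s, 0 ≤ a i)
    {η : ℝ} (hη : 0 < η) (hη1 : η ≤ 1) {M : ℕ} (hM : 0 < M) :
    ∫ α, ‖∑ i ∈ s, (a i : ℂ) * e (β i * α)‖ ^ 2 * Kf η α ≤
      M * η * ∑ i ∈ s, ∑ j ∈ s, (if M * |β i - β j| < 1 then a i * a j else 0) := by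
  have hM' : (0 : ℝ) < M := by exact_mod_cast hM
  calc _ ≤ ∫ α, (M : ℝ) ^ 2 * (‖∑ i ∈ s, (a i : ℂ) * e (β i * α)‖ ^ 2 * Kf (η / M) α) := by
        refine integral_mono (integrable_norm_sum_pow_mul_Kf s a β η 2)
          ((integrable_norm_sum_pow_mul_Kf s a β (η / M) 2).const_mul _) fun α => ?_
        have := mul_le_mul_of_nonneg_left (Kf_le_sq_mul_Kf_div hM η α)
          (sq_nonneg ‖∑ i ∈ s, (a i : ℂ) * e (β i * α)‖)
        simp only
        linarith
    _ = (M : ℝ) ^ 2 * ∑ i ∈ s, ∑ j ∈ s, a i * a j * triangle (η / M) (β i - β j) := by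
        rw [integral_const_mul, integral_norm_sum_sq_mul_Kf s a β (by positivity)]
    _ ≤ (M : ℝ) ^ 2 * ∑ i ∈ s, ∑ j ∈ s,
          (if M * |β i - β j| < 1 then a i * a j else 0) * (η / M) := by
        refine mul_le_mul_of_nonneg_left (Finset.sum_le_sum fun i hi =>
          Finset.sum_le_sum fun j hj => ?_) (by positivity)
        split_ifs with h
        · exact mul_le_mul_of_nonneg_left (triangle_le (by positivity) _)
            (mul_nonneg (ha i hi) (ha j hj))
        · rw [triangle_eq_zero, mul_zero, zero_mul]
          rw [div_le_iff₀ hM']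
          linarith
    _ = _ := by
        simp_rw [← Finset.sum_mul]
        field_simp

end Moments

open Filter

lemma eventually_fourth_moment_le {δ l : ℝ} (hδ : 0 < δ) (hl : l ≠ 0) :
    ∃ C > (0 : ℝ), ∀ᶠ X : ℝ in atTop, ∀ η : ℝ, 0 < η → η ≤ 1 →
      Integrable (fun α => ‖S 2 δ X (l * α)‖ ^ 4 * Kf η α) ∧
      ∫ α, ‖S 2 δ X (l * α)‖ ^ 4 * Kf η α ≤ C * η * (X * Real.log X ^ 4) := by
  obtain ⟨M, hM⟩ := exists_nat_ge (1 / |l|)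
  have hl' : 0 < |l| := abs_pos.2 hl
  have hM0 : 0 < M := by
    have : (0 : ℝ) < M := lt_of_lt_of_le (by positivity) hM
    exact_mod_cast this
  have hMl : 1 ≤ M * |l| := by rwa [div_le_iff₀ hl'] at hM
  refine ⟨25 * M, by positivity, ?_⟩
  filter_upwards [eventually_gt_atTop (4 / δ ^ 2), eventually_ge_atTop (Real.exp 1),
    eventually_gt_atTop 0] with X hX1 hX2 hX0 η hη hη1
  set P := (Finset.range (⌈X⌉₊ + 1)).filter
      (fun p : ℕ => p.Prime ∧ δ * X ≤ (p : ℝ) ^ (2 : ℝ) ∧ (p : ℝ) ^ (2 : ℝ) ≤ X) with hPdef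
  have hS : ∀ α, S 2 δ X (l * α) ^ 2 = ∑ i ∈ P ×ˢ P,
      ((Real.log i.1 * Real.log i.2 : ℝ) : ℂ) * e ((l * ((i.1 : ℝ) ^ 2 + (i.2 : ℝ) ^ 2)) * α) := by
    intro α
    unfold S
    rw [sq, Finset.sum_mul_sum, Finset.sum_product]
    refine Finset.sum_congr rfl fun p _ => Finset.sum_congr rfl fun q _ => ?_
    have he : ∀ x y : ℝ, e x * e y = e (x + y) := by
      intro x y
      unfold e
      rw [← Complex.exp_add]
      congr 1
      push_cast
      ring
    have e1 : (l * ((p : ℝ) ^ 2 + (q : ℝ) ^ 2)) * α =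
        (p : ℝ) ^ (2 : ℝ) * (l * α) + (q : ℝ) ^ (2 : ℝ) * (l * α) := by
      rw [Real.rpow_two, Real.rpow_two]; ring
    rw [e1, ← he]
    push_cast
    ring
  have hS4 : ∀ α, ‖S 2 δ X (l * α)‖ ^ 4 = ‖∑ i ∈ P ×ˢ P,
      ((Real.log i.1 * Real.log i.2 : ℝ) : ℂ) *
        e ((l * ((i.1 : ℝ) ^ 2 + (i.2 : ℝ) ^ 2)) * α)‖ ^ 2 := by
    intro α
    rw [← hS, norm_pow, ← pow_mul]
  simp_rw [hS4]
  refine ⟨integrable_norm_sum_pow_mul_Kf _ _ _ _ _, ?_⟩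
  refine (integral_norm_sum_sq_mul_Kf_le (P ×ˢ P) (fun i => Real.log i.1 * Real.log i.2)
    (fun i => l * ((i.1 : ℝ) ^ 2 + (i.2 : ℝ) ^ 2))
    (fun i _ => mul_nonneg (Real.log_natCast_nonneg _) (Real.log_natCast_nonneg _))
    hη hη1 hM0).trans ?_
  have hsX : 0 < √X := Real.sqrt_pos.2 hX0
  have hss : √X * √X = X := Real.mul_self_sqrt hX0.le
  have hNle : ((⌊√X⌋₊ : ℕ) : ℝ) ≤ √X := Nat.floor_le hsX.le
  have hL : 1 ≤ Real.log X := by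
    rw [← Real.log_exp 1]
    exact Real.log_le_log (Real.exp_pos 1) hX2
  have hX1' : 1 ≤ X := by
    have := Real.add_one_le_exp 1
    linarith
  have hlogN : Real.log ((⌊√X⌋₊ : ℕ) : ℝ) ≤ Real.log X := by
    rcases Nat.eq_zero_or_pos ⌊√X⌋₊ with h | h
    · rw [h]; simp; linarith
    · refine Real.log_le_log (by exact_mod_cast h) (hNle.trans ?_)
      rw [Real.sqrt_le_left (by linarith)]
      nlinarith
  have h2 : 2 * √X < δ * X := by
    have : 2 / δ < √X := by
      rw [Real.lt_sqrt (by positivity), div_pow]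
      norm_num
      exact hX1
    rw [div_lt_iff₀ hδ] at this
    nlinarith
  have hP : ∀ p ∈ P, p.Prime ∧ p ≤ ⌊√X⌋₊ ∧ 2 * ⌊√X⌋₊ < p * p := by
    intro p hp
    obtain ⟨-, hpp, h3, h4⟩ := Finset.mem_filter.1 hp
    rw [Real.rpow_two] at h3 h4
    refine ⟨hpp, Nat.le_floor (Real.le_sqrt_of_sq_le h4), ?_⟩
    have : (2 : ℝ) * (⌊√X⌋₊ : ℕ) < p * p := by nlinarith
    exact_mod_cast this
  have hmain := sum_log_equal_sums_of_two_squares_le hL hlogN hP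
  have hcmp : ∑ i ∈ P ×ˢ P, ∑ j ∈ P ×ˢ P,
      (if (M : ℝ) * |l * ((i.1 : ℝ) ^ 2 + (i.2 : ℝ) ^ 2) - l * ((j.1 : ℝ) ^ 2 + (j.2 : ℝ) ^ 2)| < 1
        then (Real.log i.1 * Real.log i.2) * (Real.log j.1 * Real.log j.2) else 0) ≤
      25 * ((⌊√X⌋₊ : ℕ) : ℝ) ^ 2 * Real.log X ^ 4 := by
    refine le_trans (Finset.sum_le_sum fun i _ => Finset.sum_le_sum fun j _ => ?_) hmain
    by_cases h : i.1 ^ 2 + i.2 ^ 2 = j.1 ^ 2 + j.2 ^ 2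
    · rw [if_pos h]
      split_ifs
      · exact le_rfl
      · have := Real.log_natCast_nonneg i.1; have := Real.log_natCast_nonneg i.2
        have := Real.log_natCast_nonneg j.1; have := Real.log_natCast_nonneg j.2
        positivity
    · rw [if_neg h, if_neg]
      rw [not_lt, ← mul_sub, abs_mul, ← mul_assoc]
      have hd : (1 : ℝ) ≤ |((i.1 : ℝ) ^ 2 + (i.2 : ℝ) ^ 2) - ((j.1 : ℝ) ^ 2 + (j.2 : ℝ) ^ 2)| := by
        have h5 : ((i.1 ^ 2 + i.2 ^ 2 : ℕ) : ℤ) - ((j.1 ^ 2 + j.2 ^ 2 : ℕ) : ℤ) ≠ 0 := by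
          intro h6
          exact h (by exact_mod_cast sub_eq_zero.1 h6)
        have := Int.one_le_abs h5
        have h7 : (1 : ℝ) ≤
            ((|((i.1 ^ 2 + i.2 ^ 2 : ℕ) : ℤ) - ((j.1 ^ 2 + j.2 ^ 2 : ℕ) : ℤ)| : ℤ) : ℝ) := by
          exact_mod_cast this
        push_cast at h7
        exact h7
      nlinarith
  calc _ ≤ M * η * (25 * ((⌊√X⌋₊ : ℕ) : ℝ) ^ 2 * Real.log X ^ 4) := by gcongr
    _ ≤ M * η * (25 * (√X) ^ 2 * Real.log X ^ 4) := by gcongr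
    _ = _ := by rw [sq, hss]; ring

lemma eventually_second_moment_le {k δ l : ℝ} (hk : 1 < k) (hδ : 0 < δ) (hl : l ≠ 0) :
    ∃ C > (0 : ℝ), ∀ᶠ X : ℝ in atTop, ∀ η : ℝ, 0 < η → η ≤ 1 →
      Integrable (fun α => ‖S k δ X (l * α)‖ ^ 2 * Kf η α) ∧
      ∫ α, ‖S k δ X (l * α)‖ ^ 2 * Kf η α ≤ C * η * (X ^ (1 / k) * Real.log X) := by
  have hl' : 0 < |l| := abs_pos.2 hl
  have hk0 : 0 < k := by linarith
  refine ⟨Real.log 4, Real.log_pos (by norm_num), ?_⟩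
  have hlim : Tendsto (fun X : ℝ => (δ * X) ^ ((k - 1) / k)) atTop atTop :=
    (tendsto_rpow_atTop (div_pos (by linarith) hk0)).comp
      (tendsto_id.const_mul_atTop hδ)
  filter_upwards [hlim.eventually_ge_atTop (1 / |l|), eventually_ge_atTop 1] with X hX hX1 η hη hη1
  have hX0 : 0 < X := by linarith
  set P := (Finset.range (⌈X⌉₊ + 1)).filter
      (fun p : ℕ => p.Prime ∧ δ * X ≤ (p : ℝ) ^ k ∧ (p : ℝ) ^ k ≤ X) with hPdef
  have hS : ∀ α, S k δ X (l * α) = ∑ p ∈ P, ((Real.log p : ℝ) : ℂ) * e ((l * (p : ℝ) ^ k) * α) := by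
    intro α
    unfold S
    refine Finset.sum_congr rfl fun p _ => ?_
    rw [mul_left_comm, mul_assoc]
  simp_rw [hS]
  refine ⟨integrable_norm_sum_pow_mul_Kf _ _ _ _ _, ?_⟩
  refine (integral_norm_sum_sq_mul_Kf_le P (fun p => Real.log p) (fun p => l * (p : ℝ) ^ k)
    (fun p _ => Real.log_natCast_nonneg p) hη hη1 one_pos).trans ?_
  have hP : ∀ p ∈ P, p.Prime ∧ (p : ℝ) ≤ X ^ (1 / k) ∧ 1 ≤ |l| * (p : ℝ) ^ (k - 1) := by
    intro p hp
    obtain ⟨-, hpp, h3, h4⟩ := Finset.mem_filter.1 hp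
    have hp0 : (0 : ℝ) ≤ p := by positivity
    refine ⟨hpp, ?_, ?_⟩
    · have := Real.rpow_le_rpow (by positivity) h4 (by positivity : 0 ≤ 1 / k)
      rwa [← Real.rpow_mul hp0, mul_one_div_cancel hk0.ne', Real.rpow_one] at this
    · have h5 : 0 ≤ (k - 1) / k := div_nonneg (by linarith) hk0.le
      have := Real.rpow_le_rpow (by positivity) h3 h5
      rw [← Real.rpow_mul hp0, mul_div_cancel₀ _ hk0.ne'] at this
      have := hX.trans this
      rwa [div_le_iff₀' hl'] at this
  have hgap : ∀ p ∈ P, ∀ q ∈ P, p < q → 1 ≤ |l * (p : ℝ) ^ k - l * (q : ℝ) ^ k| := by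
    intro p hp q hq hpq
    have hp0 : (0 : ℝ) < p := by exact_mod_cast (hP p hp).1.pos
    have hq0 : (0 : ℝ) < q := by exact_mod_cast (hP q hq).1.pos
    have hpq' : (p : ℝ) + 1 ≤ q := by exact_mod_cast hpq
    have h1 : ∀ x : ℝ, 0 < x → x ^ k = x * x ^ (k - 1) := by
      intro x hx
      rw [Real.rpow_sub_one hx.ne', mul_div_cancel₀ _ hx.ne']
    have h2 : (p : ℝ) ^ (k - 1) ≤ (q : ℝ) ^ (k - 1) :=
      Real.rpow_le_rpow hp0.le (by linarith) (by linarith)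
    have h3 : 0 < (p : ℝ) ^ (k - 1) := Real.rpow_pos_of_pos hp0 _
    have h4 : (p : ℝ) ^ (k - 1) ≤ (q : ℝ) ^ k - (p : ℝ) ^ k := by
      rw [h1 p hp0, h1 q hq0]
      nlinarith
    rw [← mul_sub, abs_mul, abs_sub_comm]
    calc 1 ≤ |l| * (p : ℝ) ^ (k - 1) := (hP p hp).2.2
      _ ≤ _ := by
        gcongr
        exact h4.trans (le_abs_self _)
  have hlogX : ∀ p ∈ P, Real.log p ≤ Real.log X := by
    intro p hp
    refine Real.log_le_log (by exact_mod_cast (hP p hp).1.pos) ((hP p hp).2.1.trans ?_)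
    exact Real.rpow_le_self_of_one_le hX1 (by rw [div_le_one hk0]; exact hk.le)
  have hsum : ∑ p ∈ P, ∑ q ∈ P, (if ((1 : ℕ) : ℝ) * |l * (p : ℝ) ^ k - l * (q : ℝ) ^ k| < 1
      then Real.log p * Real.log q else 0) ≤ Real.log 4 * X ^ (1 / k) * Real.log X := by
    calc _ = ∑ p ∈ P, Real.log p * Real.log p := by
          refine Finset.sum_congr rfl fun p hp => ?_
          rw [Finset.sum_eq_single_of_mem p hp]
          · simp
          · intro q hq hqp
            rw [if_neg]
            rw [Nat.cast_one, one_mul, not_lt]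
            rcases lt_or_gt_of_ne hqp with h | h
            · rw [abs_sub_comm]; exact hgap q hq p hp h
            · exact hgap p hp q hq h
      _ ≤ ∑ p ∈ P, Real.log p * Real.log X := by
          refine Finset.sum_le_sum fun p hp => ?_
          exact mul_le_mul_of_nonneg_left (hlogX p hp) (Real.log_natCast_nonneg p)
      _ = (∑ p ∈ P, Real.log p) * Real.log X := by rw [Finset.sum_mul]
      _ ≤ _ := by
          refine mul_le_mul_of_nonneg_right ?_ (Real.log_nonneg hX1)
          exact sum_log_primes_le (by positivity) (fun p hp => (hP p hp).1) fun p hp => (hP p hp).2.1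
  calc _ ≤ ((1 : ℕ) : ℝ) * η * (Real.log 4 * X ^ (1 / k) * Real.log X) := by gcongr
    _ = _ := by push_cast; ring

theorem statement18 (k δ l1 l2 l3 l4 : ℝ) (hk : 1 < k) (hδ0 : 0 < δ) (hδ1 : δ < 1)
    (h1 : l1 ≠ 0) (h2 : l2 ≠ 0) (h3 : l3 ≠ 0) (h4 : l4 ≠ 0)
    (u : ℝ) (hu0 : 0 < u) (hu : u ≤ 1 / 14) (ε : ℝ) (hε : 0 < ε) :
    ∃ C > (0 : ℝ), ∃ X0 : ℝ, ∀ X ≥ X0, ∀ η : ℝ, 0 < η → η ≤ 1 →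
      ∀ m' : Set ℝ, MeasurableSet m' →
      (∀ α ∈ m', ‖Stilde δ X (l1 * α)‖ ≤ X ^ ((1 : ℝ) / 2 - u + ε)) →
      (∫ α in m', ‖Stilde δ X (l1 * α)‖ * ‖S 2 δ X (l2 * α)‖ * ‖S 2 δ X (l3 * α)‖ *
          ‖S k δ X (l4 * α)‖ * Kf η α) ≤
        C * η * X ^ (1 - u + 1 / (2 * k) + ε) * (Real.log X) ^ ((5 : ℝ) / 2) := by
  obtain ⟨C2, hC2, ev2⟩ := eventually_fourth_moment_le hδ0 h2
  obtain ⟨C3, hC3, ev3⟩ := eventually_fourth_moment_le hδ0 h3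
  obtain ⟨C4, hC4, ev4⟩ := eventually_second_moment_le hk hδ0 h4
  obtain ⟨X0, hX0⟩ := eventually_atTop.1
    (ev2.and (ev3.and (ev4.and (eventually_gt_atTop (1 : ℝ)))))
  refine ⟨(C2 + C3) / 4 + C4 / 2, by positivity, X0, fun X hX η hη hη1 m' hm' hS => ?_⟩
  obtain ⟨hX2, hX3, hX4, hX1⟩ := hX0 X hX
  obtain ⟨i2, b2⟩ := hX2 η hη hη1
  obtain ⟨i3, b3⟩ := hX3 η hη hη1
  obtain ⟨i4, b4⟩ := hX4 η hη hη1
  have hXp : 0 < X := by linarith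
  have hL : 0 < Real.log X := Real.log_pos hX1
  set L := Real.log X with hLdef
  set B := X ^ ((1 : ℝ) / 2 - u + ε) with hB
  have hBp : 0 < B := Real.rpow_pos_of_pos hXp _
  set t := X ^ (1 / (2 * k) - 1 / 2) * L ^ (-(3 / 2) : ℝ) with ht
  have htp : 0 < t := by positivity
  set R := X ^ ((1 : ℝ) / 2 + 1 / (2 * k)) * L ^ ((5 : ℝ) / 2) with hR
  have hk0 : k ≠ 0 := by linarith
  have ht1 : t * (X * L ^ 4) = R := by
    have hx : X ^ (1 / (2 * k) - 1 / 2) * X = X ^ ((1 : ℝ) / 2 + 1 / (2 * k)) := by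
      rw [← Real.rpow_add_one hXp.ne']; congr 1; ring
    have hl : L ^ (-(3 / 2) : ℝ) * L ^ 4 = L ^ ((5 : ℝ) / 2) := by
      rw [← Real.rpow_add_natCast hL.ne']; norm_num
    rw [ht, hR, ← hx, ← hl]; ring
  have ht2 : X ^ (1 / k) * L = R * t := by
    have hx : X ^ ((1 : ℝ) / 2 + 1 / (2 * k)) * X ^ (1 / (2 * k) - 1 / 2) = X ^ (1 / k) := by
      rw [← Real.rpow_add hXp]; congr 1; field_simp; ring
    have hl : L ^ ((5 : ℝ) / 2) * L ^ (-(3 / 2) : ℝ) = L := by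
      rw [← Real.rpow_add hL]; norm_num
    calc _ = (X ^ ((1 : ℝ) / 2 + 1 / (2 * k)) * X ^ (1 / (2 * k) - 1 / 2)) *
          (L ^ ((5 : ℝ) / 2) * L ^ (-(3 / 2) : ℝ)) := by rw [hx, hl]
      _ = _ := by rw [ht, hR]; ring
  set g : ℝ → ℝ := fun α => B * (t / 4 * (‖S 2 δ X (l2 * α)‖ ^ 4 * Kf η α +
    ‖S 2 δ X (l3 * α)‖ ^ 4 * Kf η α) + 1 / (2 * t) * (‖S k δ X (l4 * α)‖ ^ 2 * Kf η α)) with hg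
  have i23 : Integrable fun α => ‖S 2 δ X (l2 * α)‖ ^ 4 * Kf η α +
      ‖S 2 δ X (l3 * α)‖ ^ 4 * Kf η α := i2.add i3
  have hgi : Integrable g :=
    ((i23.const_mul (t / 4)).add (i4.const_mul (1 / (2 * t)))).const_mul B
  have hg0 : ∀ α, 0 ≤ g α := by
    intro α
    have := Kf_nonneg η α
    simp only [hg]
    positivity
  have hle : ∀ α ∈ m', ‖Stilde δ X (l1 * α)‖ * ‖S 2 δ X (l2 * α)‖ * ‖S 2 δ X (l3 * α)‖ *
      ‖S k δ X (l4 * α)‖ * Kf η α ≤ g α := by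
    intro α hα
    have hK := Kf_nonneg η α
    have hamgm : ∀ a b c : ℝ, a * b * c ≤ t / 4 * (a ^ 4 + b ^ 4) + 1 / (2 * t) * c ^ 2 := by
      intro a b c
      have h : t / 4 * (a ^ 4 + b ^ 4) + 1 / (2 * t) * c ^ 2 - a * b * c =
          t / 4 * (a ^ 2 - b ^ 2) ^ 2 + 1 / (2 * t) * (t * (a * b) - c) ^ 2 := by
        field_simp; ring
      have : 0 ≤ t / 4 * (a ^ 2 - b ^ 2) ^ 2 + 1 / (2 * t) * (t * (a * b) - c) ^ 2 := by positivity
      linarith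
    calc _ = ‖Stilde δ X (l1 * α)‖ * (‖S 2 δ X (l2 * α)‖ * ‖S 2 δ X (l3 * α)‖ *
          ‖S k δ X (l4 * α)‖) * Kf η α := by ring
      _ ≤ B * (t / 4 * (‖S 2 δ X (l2 * α)‖ ^ 4 + ‖S 2 δ X (l3 * α)‖ ^ 4) +
          1 / (2 * t) * ‖S k δ X (l4 * α)‖ ^ 2) * Kf η α := by
        gcongr
        · exact hS α hα
        · exact hamgm _ _ _
      _ = g α := by simp only [hg]; ring
  calc _ ≤ ∫ α in m', g α := by
        refine integral_mono_of_nonneg (Eventually.of_forall fun α => ?_) hgi.integrableOn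
          ((ae_restrict_iff' hm').2 (Eventually.of_forall hle))
        have := Kf_nonneg η α
        simp only [Pi.zero_apply]
        positivity
    _ ≤ ∫ α, g α := setIntegral_le_integral hgi (Eventually.of_forall hg0)
    _ = B * (t / 4 * ((∫ α, ‖S 2 δ X (l2 * α)‖ ^ 4 * Kf η α) +
          ∫ α, ‖S 2 δ X (l3 * α)‖ ^ 4 * Kf η α) +
          1 / (2 * t) * ∫ α, ‖S k δ X (l4 * α)‖ ^ 2 * Kf η α) := by
        simp only [hg]
        rw [integral_const_mul, integral_add (i23.const_mul (t / 4))
          (i4.const_mul (1 / (2 * t))), integral_const_mul, integral_const_mul,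
          integral_add i2 i3]
    _ ≤ B * (t / 4 * (C2 * η * (X * L ^ 4) + C3 * η * (X * L ^ 4)) +
          1 / (2 * t) * (C4 * η * (X ^ (1 / k) * L))) := by gcongr
    _ = B * (((C2 + C3) / 4 * η) * (t * (X * L ^ 4)) +
          C4 / 2 * η * (1 / t * (X ^ (1 / k) * L))) := by ring
    _ = ((C2 + C3) / 4 + C4 / 2) * η * (B * R) := by
        rw [ht1, ht2]
        field_simp
    _ = _ := by
        have : B * X ^ ((1 : ℝ) / 2 + 1 / (2 * k)) = X ^ (1 - u + 1 / (2 * k) + ε) := by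
          rw [hB, ← Real.rpow_add hXp]; congr 1; ring
        rw [hR, ← mul_assoc B, this]
        ring

end
end
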